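/- arXiv:1702.04489 — 4 statements merged into one kernel-verified Lean document; each statement's English description precedes it below -/
import Mathlib

section
/- Let a > 0. There exists a constant C₃ = C₃(d,α,a) > 0 such that for every nonnegative Borel measure μ on ℝ^d, every t > 0 and all x, y ∈ ℝ^d, ∫₀^t ∫_{ℝ^d} Γ_a(t−s; x−z)·η(s; z−y) μ(dz) ds ≤ C₃·( Γ_a(t; x−y)·sup_{x'∈ℝ^d} ∫₀^t ∫_{ℝ^d} η(s; x'−y') μ(dy') ds + η(t; x−y)·sup_{x'∈ℝ^d} ∫₀^t ∫_{ℝ^d} Γ_a(s; x'−y') μ(dy') ds ), where all quantities are allowed to be +∞. -/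
open MeasureTheory Set ENNReal

noncomputable def Gam (d : ℕ) (lam t : ℝ) (x : EuclideanSpace ℝ (Fin d)) : ℝ :=
  t ^ (-(d : ℝ) / 2) * Real.exp (-lam * ‖x‖ ^ 2 / t)

noncomputable def eta (d : ℕ) (α t : ℝ) (x : EuclideanSpace ℝ (Fin d)) : ℝ :=
  t / (t ^ ((1 : ℝ) / 2) + ‖x‖) ^ ((d : ℝ) + α)

lemma aux_eta_le {d : ℕ} {α : ℝ} (hα : 0 < α) {s t ρ : ℝ} (hs : 0 < s) (hst : s ≤ t) (hρ : 0 < ρ)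
    (v : EuclideanSpace ℝ (Fin d)) (h : ρ ≤ s ^ ((1:ℝ)/2) + ‖v‖) :
    eta d α s v ≤ t / ρ ^ ((d:ℝ) + α) := by
  unfold eta
  have : ρ ^ ((d:ℝ)+α) ≤ (s ^ ((1:ℝ)/2) + ‖v‖) ^ ((d:ℝ)+α) :=
    Real.rpow_le_rpow hρ.le h (by positivity)
  have h2 : 0 < ρ ^ ((d:ℝ)+α) := by positivity
  gcongr
  linarith

lemma aux_eta_ge {d : ℕ} {α : ℝ} (hα : 0 < α) {t ρ : ℝ} (ht : 0 < t)
    (v : EuclideanSpace ℝ (Fin d)) (h : t ^ ((1:ℝ)/2) + ‖v‖ ≤ ρ) :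
    t / ρ ^ ((d:ℝ) + α) ≤ eta d α t v := by
  unfold eta
  have h1 : 0 < t ^ ((1:ℝ)/2) := by positivity
  have h0 : 0 < t ^ ((1:ℝ)/2) + ‖v‖ := by positivity
  have : (t ^ ((1:ℝ)/2) + ‖v‖) ^ ((d:ℝ)+α) ≤ ρ ^ ((d:ℝ)+α) :=
    Real.rpow_le_rpow h0.le h (by positivity)
  have h2 : 0 < (t ^ ((1:ℝ)/2) + ‖v‖) ^ ((d:ℝ)+α) := by positivity
  gcongr

/-- comparison of eta values -/
lemma aux_eta_cmp {d : ℕ} {α : ℝ} (hα : 0 < α) {s t c : ℝ} (hs : 0 < s) (hst : s ≤ t) (hc : 0 < c)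
    (v w : EuclideanSpace ℝ (Fin d))
    (h : t ^ ((1:ℝ)/2) + ‖w‖ ≤ c * (s ^ ((1:ℝ)/2) + ‖v‖)) :
    eta d α s v ≤ c ^ ((d:ℝ) + α) * eta d α t w := by
  have ht : 0 < t := hs.trans_le hst
  have h1 : 0 < s ^ ((1:ℝ)/2) := by positivity
  have h2 : 0 < s ^ ((1:ℝ)/2) + ‖v‖ := by positivity
  refine (aux_eta_le hα hs hst h2 v le_rfl).trans ?_
  refine le_trans ?_ (mul_le_mul_of_nonneg_left (aux_eta_ge hα ht w h) (by positivity))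
  rw [Real.mul_rpow hc.le h2.le]
  have h3 : 0 < c ^ ((d:ℝ) + α) := by positivity
  apply le_of_eq
  field_simp

lemma aux_Gam_le {d : ℕ} {a : ℝ} (ha : 0 < a) {r t : ℝ} (ht : 0 < t) (hr : t / 2 ≤ r)
    (u w : EuclideanSpace ℝ (Fin d)) (hw : ‖w‖ ≤ t ^ ((1:ℝ)/2)) :
    Gam d a r u ≤ (2 ^ ((d:ℝ)/2) * Real.exp a) * Gam d a t w := by
  unfold Gam
  have hr0 : 0 < r := by linarith
  have h1 : r ^ (-(d:ℝ)/2) ≤ 2 ^ ((d:ℝ)/2) * t ^ (-(d:ℝ)/2) := by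
    have : r ^ (-(d:ℝ)/2) ≤ (t/2) ^ (-(d:ℝ)/2) :=
      Real.rpow_le_rpow_of_nonpos (by positivity) hr
        (by have : (0:ℝ) ≤ d := by positivity
            linarith)
    refine this.trans (le_of_eq ?_)
    rw [Real.div_rpow ht.le (by norm_num), neg_div, Real.rpow_neg (by norm_num : (0:ℝ) ≤ 2)]
    field_simp
  have h2 : Real.exp (-a * ‖u‖^2 / r) ≤ 1 := by
    rw [Real.exp_le_one_iff]
    apply div_nonpos_of_nonpos_of_nonneg _ hr0.le
    nlinarith [sq_nonneg ‖u‖]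
  have h3 : 1 ≤ Real.exp a * Real.exp (-a * ‖w‖^2/t) := by
    rw [← Real.exp_add]
    apply Real.one_le_exp
    have hw2 : ‖w‖^2 ≤ t := by
      have := pow_le_pow_left₀ (norm_nonneg w) hw 2
      rwa [← Real.sqrt_eq_rpow, Real.sq_sqrt ht.le] at this
    have : ‖w‖^2/t ≤ 1 := by rw [div_le_one ht]; exact hw2
    have : -a * ‖w‖^2/t = -a * (‖w‖^2/t) := by ring
    rw [this]
    nlinarith
  calc _ ≤ (2 ^ ((d:ℝ)/2) * t ^ (-(d:ℝ)/2)) * 1 := by gcongr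
    _ ≤ (2 ^ ((d:ℝ)/2) * t ^ (-(d:ℝ)/2)) * (Real.exp a * Real.exp (-a * ‖w‖^2/t)) := by gcongr
    _ = _ := by ring

lemma aux_Gam_far (d : ℕ) {a : ℝ} (ha : 0 < a) :
    ∃ C : ℝ, 0 < C ∧ ∀ r t : ℝ, 0 < r → r ≤ t → ∀ u : EuclideanSpace ℝ (Fin d), ∀ W : ℝ,
      t ≤ W ^ 2 → 0 ≤ W → 3/4 * W ≤ ‖u‖ →
      Gam d a r u ≤ C * (t ^ (-(d:ℝ)/2) * Real.exp (-(a/2) * (W^2/t))) := by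
  refine ⟨(d+1).factorial * (16/a)^(d+1) + 1 + Real.exp (a/16), by positivity, ?_⟩
  intro r t hr hrt u W hW hW0 hu
  have ht : 0 < t := hr.trans_le hrt
  unfold Gam
  set p := t / r with hp
  have hp1 : 1 ≤ p := by rw [hp, one_le_div hr]; exact hrt
  have hrp : r = t / p := by rw [hp]; field_simp
  have e1 : r ^ (-(d:ℝ)/2) = p ^ ((d:ℝ)/2) * t ^ (-(d:ℝ)/2) := by
    rw [hrp, Real.div_rpow ht.le (by positivity), neg_div, Real.rpow_neg (by positivity : (0:ℝ) ≤ p)]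
    field_simp
  set Q := W^2/t with hQ
  have hQ1 : 1 ≤ Q := by rw [hQ, one_le_div ht]; exact hW
  have e2 : -a * ‖u‖^2 / r ≤ -(a/2) * Q + -(a/16*p) := by
    have h1 : (9/16) * W^2 ≤ ‖u‖^2 := by nlinarith
    have h2 : (9/16) * (Q * p) ≤ ‖u‖^2 / r := by
      have : Q * p = W^2 / r := by rw [hQ, hp]; field_simp
      rw [this, le_div_iff₀ hr]
      calc 9/16*(W^2/r) * r = 9/16*W^2 := by field_simp
        _ ≤ _ := h1
    have h3 : 1/2 * Q + 1/16*p ≤ 9/16*(Q*p) := by nlinarith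
    have : -a * ‖u‖^2 / r = -(a * (‖u‖^2/r)) := by ring
    rw [this]
    nlinarith
  have e3 : p ^ ((d:ℝ)/2) * Real.exp (-(a/16*p)) ≤ (d+1).factorial * (16/a)^(d+1) := by
    have h1 : p ^ ((d:ℝ)/2) ≤ p ^ (d+1) := by
      rw [← Real.rpow_natCast]
      apply Real.rpow_le_rpow_of_exponent_le hp1
      push_cast
      have : (0:ℝ) ≤ d := by positivity
      linarith
    have h2 := Real.pow_div_factorial_le_exp (a/16*p) (by positivity) (d+1)
    rw [Real.exp_neg, ← div_eq_mul_inv, div_le_iff₀ (Real.exp_pos _)]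
    refine h1.trans ?_
    calc p^(d+1) = (d+1).factorial * (16/a)^(d+1) * ((a/16*p)^(d+1)/(d+1).factorial) := by
          simp only [mul_pow, div_pow]; field_simp
      _ ≤ _ := by gcongr
  calc _ ≤ p ^ ((d:ℝ)/2) * t ^ (-(d:ℝ)/2) * Real.exp (-(a/2) * Q + -(a/16*p)) := by
        rw [e1]; gcongr
    _ = (p ^ ((d:ℝ)/2) * Real.exp (-(a/16*p))) * (t ^ (-(d:ℝ)/2) * Real.exp (-(a/2) * Q)) := by
        rw [Real.exp_add]; ring
    _ ≤ _ := by
        gcongr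
        have : 0 < Real.exp (a/16) := Real.exp_pos _
        linarith

/-- covering -/
lemma aux_cover (d : ℕ) : ∃ K : ℕ, 1 ≤ K ∧ ∀ (μ : Measure (EuclideanSpace ℝ (Fin d))) (ρ : ℝ) (S : ℝ≥0∞),
    0 < ρ → (∀ x, μ (Metric.ball x ρ) ≤ S) →
    ∀ (n : ℕ) x, μ (Metric.ball x (2^n * ρ)) ≤ (K:ℝ≥0∞)^n * S := by
  have hc : IsCompact (Metric.closedBall (0 : EuclideanSpace ℝ (Fin d)) 2) :=
    isCompact_closedBall _ _
  obtain ⟨T, -, hTf, hT⟩ := hc.finite_cover_balls (e := 1) one_pos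
  lift T to Finset (EuclideanSpace ℝ (Fin d)) using hTf
  refine ⟨T.card + 1, by omega, ?_⟩
  intro μ ρ S hρ hS n
  induction n with
  | zero => intro x; simpa using hS x
  | succ n ih =>
    intro x
    have hR : 0 < 2^n * ρ := by positivity
    set R := 2^n * ρ with hRdef
    have hsub : Metric.ball x (2^(n+1) * ρ) ⊆ ⋃ f ∈ T, Metric.ball (x + R • f) R := by
      intro z hz
      have hz' : ‖z - x‖ < 2 * R := by
        rw [Metric.mem_ball, dist_eq_norm] at hz
        rw [hRdef]; rw [pow_succ] at hz; linarith
      have hm : R⁻¹ • (z - x) ∈ Metric.closedBall (0 : EuclideanSpace ℝ (Fin d)) 2 := by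
        rw [mem_closedBall_zero_iff, norm_smul, norm_inv, Real.norm_of_nonneg hR.le,
          inv_mul_le_iff₀ hR]
        linarith
      have := hT hm
      simp only [mem_iUnion, Finset.mem_coe, exists_prop] at this ⊢
      obtain ⟨f, hf, hfz⟩ := this
      refine ⟨f, hf, ?_⟩
      rw [Metric.mem_ball, dist_eq_norm] at hfz ⊢
      have e : z - (x + R • f) = R • (R⁻¹ • (z - x) - f) := by
        rw [smul_sub, smul_inv_smul₀ hR.ne']; abel
      rw [e, norm_smul, Real.norm_of_nonneg hR.le]
      nlinarith
    calc μ (Metric.ball x (2^(n+1) * ρ)) ≤ μ (⋃ f ∈ T, Metric.ball (x + R • f) R) := measure_mono hsub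
      _ ≤ ∑ f ∈ T, μ (Metric.ball (x + R • f) R) := measure_biUnion_finset_le _ _
      _ ≤ ∑ f ∈ T, (((T.card + 1 : ℕ) : ℝ≥0∞)^n * S) := Finset.sum_le_sum fun f _ => ih _
      _ = (T.card : ℝ≥0∞) * (((T.card + 1 : ℕ) : ℝ≥0∞)^n * S) := by simp
      _ ≤ ((T.card + 1 : ℕ) : ℝ≥0∞) * (((T.card + 1 : ℕ) : ℝ≥0∞)^n * S) := by
          gcongr; exact Nat.le_succ _
      _ = _ := by rw [pow_succ]; ring

/-- ball growth -/
lemma aux_ball (d : ℕ) {a : ℝ} (ha : 0 < a) (μ : Measure (EuclideanSpace ℝ (Fin d))) (t ρ : ℝ)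
    (hρ : 0 < ρ) (hρt : ρ ^ 2 ≤ t) (x : EuclideanSpace ℝ (Fin d)) (N : ℝ≥0∞)
    (hN : ∫⁻ s in Set.Ioc (0 : ℝ) t, ∫⁻ y', ENNReal.ofReal (Gam d a s (x - y')) ∂μ ≤ N) :
    μ (Metric.ball x ρ) ≤ ENNReal.ofReal (2 * Real.exp (2*a) * (ρ^d / ρ^2)) * N := by
  have key : ENNReal.ofReal (ρ^2/2 * ((ρ^d)⁻¹ * Real.exp (-(2*a)))) * μ (Metric.ball x ρ) ≤ N := by
    refine le_trans ?_ hN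
    have hsub : Set.Ioc (ρ^2/2) (ρ^2) ⊆ Set.Ioc 0 t := fun s hs =>
      ⟨lt_of_le_of_lt (by positivity) hs.1, hs.2.trans hρt⟩
    refine le_trans ?_ (lintegral_mono_set hsub)
    have inner : ∀ s ∈ Set.Ioc (ρ^2/2) (ρ^2),
        ENNReal.ofReal ((ρ^d)⁻¹ * Real.exp (-(2*a))) * μ (Metric.ball x ρ) ≤
          ∫⁻ y', ENNReal.ofReal (Gam d a s (x - y')) ∂μ := by
      intro s hs
      have hs0 : 0 < s := lt_of_le_of_lt (by positivity) hs.1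
      rw [← setLIntegral_const]
      refine le_trans ?_ (setLIntegral_le_lintegral (Metric.ball x ρ) _)
      refine setLIntegral_mono' measurableSet_ball ?_
      intro z hz
      apply ENNReal.ofReal_le_ofReal
      unfold Gam
      have hz' : ‖x - z‖ < ρ := by rwa [Metric.mem_ball', dist_eq_norm] at hz
      have h1 : (ρ^d)⁻¹ ≤ s ^ (-(d:ℝ)/2) := by
        have : (ρ^d)⁻¹ = (ρ^2) ^ (-(d:ℝ)/2) := by
          rw [← Real.rpow_natCast ρ 2, ← Real.rpow_mul hρ.le, ← Real.rpow_natCast,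
            ← Real.rpow_neg hρ.le]
          congr 1; push_cast; ring
        rw [this]
        exact Real.rpow_le_rpow_of_nonpos hs0 hs.2
          (by have : (0:ℝ) ≤ d := by positivity
              linarith)
      have h2 : -(2*a) ≤ -a * ‖x - z‖^2/s := by
        rw [le_div_iff₀ hs0]
        have : ‖x - z‖^2 ≤ ρ^2 := by gcongr
        have := hs.1
        nlinarith
      gcongr
    calc _ = ∫⁻ s in Set.Ioc (ρ^2/2) (ρ^2),
        ENNReal.ofReal ((ρ^d)⁻¹ * Real.exp (-(2*a))) * μ (Metric.ball x ρ) := by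
          rw [setLIntegral_const, Real.volume_Ioc, ENNReal.ofReal_mul (by positivity)]
          have : ρ^2 - ρ^2/2 = ρ^2/2 := by ring
          rw [this]; ring
      _ ≤ _ := setLIntegral_mono' measurableSet_Ioc inner
  calc μ (Metric.ball x ρ) = ENNReal.ofReal (2 * Real.exp (2*a) * (ρ^d / ρ^2)) *
      (ENNReal.ofReal (ρ^2/2 * ((ρ^d)⁻¹ * Real.exp (-(2*a)))) * μ (Metric.ball x ρ)) := by
        rw [← mul_assoc, ← ENNReal.ofReal_mul (by positivity)]
        have : (2 * Real.exp (2*a) * (ρ^d / ρ^2)) * (ρ^2/2 * ((ρ^d)⁻¹ * Real.exp (-(2*a)))) = 1 := by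
          rw [Real.exp_neg]
          have := Real.exp_pos (2*a)
          field_simp
        rw [this]; simp
    _ ≤ _ := by gcongr

lemma aux_scalar {a b : ℝ} (ha : 0 < a) (hb : 0 < b) (K : ℕ) (hK : 1 ≤ K) :
    ∃ C : ℝ, 0 < C ∧ ∀ q : ℝ, 0 ≤ q → ∀ n : ℕ, (n:ℝ) ≤ q + 1 →
      Real.exp (-(a/2) * q^2) * (K:ℝ)^n * (2*q)^b ≤ C := by
  set L := Real.log K with hL
  have hK' : (1:ℝ) ≤ K := by exact_mod_cast hK
  have hL0 : 0 ≤ L := Real.log_nonneg hK'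
  refine ⟨Real.exp ((L+2*b)^2/(2*a) + L), Real.exp_pos _, ?_⟩
  intro q hq n hn
  have h1 : (K:ℝ)^n ≤ Real.exp ((q+1)*L) := by
    have : (K:ℝ)^n = Real.exp (n * L) := by
      rw [mul_comm, ← Real.rpow_natCast, Real.rpow_def_of_pos (by linarith)]
    rw [this]; gcongr
  have h2 : (2*q)^b ≤ Real.exp (2*q*b) := by
    have : Real.exp (2*q*b) = (Real.exp (2*q))^b := by rw [Real.exp_mul]
    rw [this]
    apply Real.rpow_le_rpow (by positivity) _ hb.le
    have := Real.add_one_le_exp (2*q)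
    linarith
  calc _ ≤ Real.exp (-(a/2) * q^2) * Real.exp ((q+1)*L) * Real.exp (2*q*b) := by gcongr
    _ = Real.exp (-(a/2) * q^2 + (q+1)*L + 2*q*b) := by rw [Real.exp_add, Real.exp_add]
    _ ≤ _ := by
      apply Real.exp_le_exp.mpr
      have : (L+2*b)^2/(2*a) - (L+2*b)*q + a/2*q^2 = ((L+2*b) - a*q)^2/(2*a) := by field_simp; ring
      have h3 : 0 ≤ ((L+2*b) - a*q)^2/(2*a) := by positivity
      nlinarith

lemma aux_dyadic {d : ℕ} (hd : 2 ≤ d) {α : ℝ} (hα : 0 < α) {A : ℝ} (hA : 0 < A)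
    (μ : Measure (EuclideanSpace ℝ (Fin d))) (y : EuclideanSpace ℝ (Fin d)) {s τ : ℝ} (hs : 0 < s)
    (hτ : 0 < τ) (N : ℝ≥0∞)
    (hball : ∀ ρ, 0 < ρ → ρ ≤ τ → μ (Metric.ball y ρ) ≤ ENNReal.ofReal (A * (ρ^d/ρ^2)) * N) :
    ∫⁻ z in Metric.ball y τ, ENNReal.ofReal (eta d α s (z - y)) ∂μ ≤
      ENNReal.ofReal (2 * A * 2^((d:ℝ)+α) * s^(-α/2)) * N := by
  set b := (d:ℝ) + α with hb
  have hb0 : 0 < b := by positivity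
  set σ := s^((1:ℝ)/2) with hσ
  have hσ0 : 0 < σ := by positivity
  set c : ℕ → ℝ := fun k => s / (2^k*σ/2)^b with hc
  have hc0 : ∀ k, 0 ≤ c k := fun k => by simp only [hc]; positivity
  have pw : ∀ z ∈ Metric.ball y τ, ENNReal.ofReal (eta d α s (z - y)) ≤
      ∑' k : ℕ, (Metric.ball y (min (2^k*σ) τ)).indicator (fun _ => ENNReal.ofReal (c k)) z := by
    intro z hz
    have hz' : ‖z - y‖ < τ := by rwa [Metric.mem_ball, dist_eq_norm] at hz
    have hex : ∃ k : ℕ, ‖z - y‖ < 2^k*σ := by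
      obtain ⟨k, hk⟩ := pow_unbounded_of_one_lt (‖z-y‖/σ) (by norm_num : (1:ℝ) < 2)
      exact ⟨k, by rwa [div_lt_iff₀ hσ0] at hk⟩
    classical
    obtain ⟨k, hk, hmin⟩ : ∃ k : ℕ, ‖z - y‖ < 2^k*σ ∧ ∀ j < k, ¬ ‖z - y‖ < 2^j*σ :=
      ⟨Nat.find hex, Nat.find_spec hex, fun j hj => Nat.find_min hex hj⟩
    refine le_trans ?_ (ENNReal.le_tsum k)
    rw [Set.indicator_of_mem (by rw [Metric.mem_ball, dist_eq_norm]; exact lt_min hk hz')]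
    apply ENNReal.ofReal_le_ofReal
    apply aux_eta_le hα hs le_rfl (by positivity)
    rcases k with _ | k
    · have := norm_nonneg (z-y)
      simp only [pow_zero, one_mul]
      linarith
    · have := hmin k (by omega)
      rw [pow_succ]
      linarith
  have term : ∀ k : ℕ, ENNReal.ofReal (c k) * μ (Metric.ball y (min (2^k*σ) τ)) ≤
      ENNReal.ofReal ((A * 2^b * s^(-α/2)) * (1/2)^k) * N := by
    intro k
    set ρ := 2^k*σ with hρ
    have hρ0 : 0 < ρ := by positivity
    have hm : μ (Metric.ball y (min ρ τ)) ≤ ENNReal.ofReal (A * (ρ^d/ρ^2)) * N := by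
      refine (hball (min ρ τ) (lt_min hρ0 hτ) (min_le_right _ _)).trans ?_
      gcongr ENNReal.ofReal (A * ?_) * N
      have e : ∀ x : ℝ, 0 < x → x^d/x^2 = x^(d-2) := by
        intro x hx
        rw [div_eq_iff (by positivity), ← pow_add]; congr 1; omega
      rw [e _ (lt_min hρ0 hτ), e _ hρ0]
      have := (lt_min hρ0 hτ).le
      gcongr
      exact min_le_left _ _
    calc _ ≤ ENNReal.ofReal (c k) * (ENNReal.ofReal (A * (ρ^d/ρ^2)) * N) := by gcongr
      _ = ENNReal.ofReal (c k * (A * (ρ^d/ρ^2))) * N := by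
        rw [ENNReal.ofReal_mul (hc0 k), mul_assoc]
      _ ≤ _ := by
        gcongr ENNReal.ofReal ?_ * N
        have e1 : c k * (A * (ρ^d/ρ^2)) = A * 2^b * (s * ρ^(-α-2)) := by
          simp only [hc]
          rw [Real.div_rpow hρ0.le (by norm_num)]
          have : ρ^(-α-2) = ρ^d/ρ^2/ρ^b := by
            rw [← Real.rpow_natCast ρ d, ← Real.rpow_natCast ρ 2, ← Real.rpow_sub hρ0,
              ← Real.rpow_sub hρ0]
            congr 1; rw [hb]; push_cast; ring
          rw [this]
          field_simp
        have e2 : ρ^(-α-2) = (2^k : ℝ)^(-α-2) * s^(-α/2-1) := by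
          rw [hρ, Real.mul_rpow (by positivity) hσ0.le, hσ, ← Real.rpow_mul hs.le]
          congr 2; ring
        have e3 : (2^k : ℝ)^(-α-2) ≤ (1/2)^k := by
          have h1 : (1:ℝ) ≤ 2^k := one_le_pow₀ (by norm_num)
          have : (2^k : ℝ)^(-α-2) ≤ (2^k : ℝ)^(-1:ℝ) :=
            Real.rpow_le_rpow_of_exponent_le h1 (by linarith)
          rwa [Real.rpow_neg_one, ← inv_pow, ← one_div] at this
        have e4 : s * s^(-α/2-1) = s^(-α/2) := by
          rw [Real.rpow_sub_one hs.ne']; field_simp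
        rw [e1, e2]
        calc A * 2^b * (s * ((2^k : ℝ)^(-α-2) * s^(-α/2-1))) =
            A * 2^b * (s * s^(-α/2-1)) * (2^k : ℝ)^(-α-2) := by ring
          _ ≤ _ := by rw [e4]; gcongr
  calc _ ≤ ∫⁻ z in Metric.ball y τ,
        ∑' k : ℕ, (Metric.ball y (min (2^k*σ) τ)).indicator (fun _ => ENNReal.ofReal (c k)) z ∂μ :=
        setLIntegral_mono' measurableSet_ball pw
    _ ≤ ∫⁻ z, ∑' k : ℕ, (Metric.ball y (min (2^k*σ) τ)).indicator
          (fun _ => ENNReal.ofReal (c k)) z ∂μ := setLIntegral_le_lintegral _ _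
    _ = ∑' k : ℕ, ENNReal.ofReal (c k) * μ (Metric.ball y (min (2^k*σ) τ)) := by
        rw [lintegral_tsum (fun k => (measurable_const.indicator measurableSet_ball).aemeasurable)]
        congr 1; ext k
        rw [lintegral_indicator_const measurableSet_ball]
    _ ≤ ∑' k : ℕ, ENNReal.ofReal ((A * 2^b * s^(-α/2)) * (1/2)^k) * N := ENNReal.tsum_le_tsum term
    _ = _ := by
        rw [ENNReal.tsum_mul_right, ← ENNReal.ofReal_tsum_of_nonneg (fun k => by positivity)
          (summable_geometric_two.mul_left _), tsum_mul_left, tsum_geometric_two]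
        congr 2; ring

lemma aux_int {α t : ℝ} (hα2 : α < 2) (ht : 0 < t) :
    ∫⁻ s in Set.Ioc (0:ℝ) t, ENNReal.ofReal (s^(-α/2)) = ENNReal.ofReal (t^(1-α/2)/(1-α/2)) := by
  have hi : IntervalIntegrable (fun s : ℝ => s^(-α/2)) volume 0 t :=
    intervalIntegral.intervalIntegrable_rpow' (by linarith)
  rw [intervalIntegrable_iff_integrableOn_Ioc_of_le ht.le] at hi
  rw [← ofReal_integral_eq_lintegral_ofReal hi, ← intervalIntegral.integral_of_le ht.le,
    integral_rpow (Or.inl (by linarith)), Real.zero_rpow (by linarith)]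
  · congr 2
    · rw [sub_zero]; congr 1; ring
    · ring
  · filter_upwards [ae_restrict_mem measurableSet_Ioc] with s hs
    have := hs.1
    positivity

lemma aux_refl {t : ℝ} (f : ℝ → ℝ≥0∞) :
    ∫⁻ s in Set.Ioc (0:ℝ) t, f (t - s) = ∫⁻ s in Set.Ioc (0:ℝ) t, f s := by
  rw [← restrict_Ioo_eq_restrict_Ioc]
  have hmp : MeasurePreserving (fun s : ℝ => t - s) volume volume :=
    Measure.measurePreserving_sub_left volume t
  have he : MeasurableEmbedding (fun s : ℝ => t - s) := (MeasurableEquiv.subLeft t).measurableEmbedding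
  have := hmp.setLIntegral_comp_preimage_emb he f (Set.Ioo 0 t)
  rw [← this]
  congr 2
  ext s; simp [and_comm]

/-- the far part, for fixed time -/
lemma aux_far {d : ℕ} (hd : 2 ≤ d) {α : ℝ} (hα : 0 < α) {a : ℝ} (ha : 0 < a) (K : ℕ) (hK1 : 1 ≤ K)
    (hK : ∀ (μ : Measure (EuclideanSpace ℝ (Fin d))) (ρ : ℝ) (S : ℝ≥0∞),
      0 < ρ → (∀ x, μ (Metric.ball x ρ) ≤ S) →
      ∀ (n : ℕ) x, μ (Metric.ball x (2^n * ρ)) ≤ (K:ℝ≥0∞)^n * S)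
    (μ : Measure (EuclideanSpace ℝ (Fin d))) (y : EuclideanSpace ℝ (Fin d)) {s t W : ℝ} (hs : 0 < s)
    (hst : s ≤ t) (N : ℝ≥0∞)
    (hN : ∀ x, ∫⁻ s in Set.Ioc (0 : ℝ) t, ∫⁻ y', ENNReal.ofReal (Gam d a s (x - y')) ∂μ ≤ N)
    (n : ℕ) (hn : W ≤ 2^n * t^((1:ℝ)/2)) :
    ∫⁻ z in Metric.ball y W, ENNReal.ofReal (eta d α s (z - y)) ∂μ ≤
      ENNReal.ofReal ((2 * Real.exp (2*a) * (2 * 2^((d:ℝ)+α) + 1)) * (K:ℝ)^n * s^(-α/2)) * N := by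
  have ht : 0 < t := hs.trans_le hst
  set τ := t^((1:ℝ)/2) with hτ
  have hτ0 : 0 < τ := by positivity
  have hτ2 : τ^2 = t := by rw [hτ, ← Real.sqrt_eq_rpow, Real.sq_sqrt ht.le]
  set A := 2 * Real.exp (2*a) with hA
  have hA0 : 0 < A := by positivity
  set b := (d:ℝ) + α with hb
  have hb0 : 0 < b := by positivity
  have hball : ∀ x, ∀ ρ, 0 < ρ → ρ ≤ τ → μ (Metric.ball x ρ) ≤ ENNReal.ofReal (A * (ρ^d/ρ^2)) * N := by
    intro x ρ hρ hρτ
    exact aux_ball d ha μ t ρ hρ (by rw [← hτ2]; gcongr) x N (hN x)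
  have h1 := aux_dyadic hd hα hA0 μ y hs hτ0 N (hball y)
  have h2 : ∫⁻ z in Metric.ball y W \ Metric.ball y τ, ENNReal.ofReal (eta d α s (z - y)) ∂μ ≤
      ENNReal.ofReal (A * (K:ℝ)^n * s^(-α/2)) * N := by
    calc _ ≤ ∫⁻ z in Metric.ball y W \ Metric.ball y τ, ENNReal.ofReal (t / τ^b) ∂μ := by
          refine setLIntegral_mono' (measurableSet_ball.diff measurableSet_ball) ?_
          intro z hz
          apply ENNReal.ofReal_le_ofReal
          apply aux_eta_le hα hs hst hτ0
          have h3 := hz.2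
          rw [Metric.mem_ball, dist_eq_norm, not_lt] at h3
          have : 0 ≤ s^((1:ℝ)/2) := by positivity
          linarith
      _ = ENNReal.ofReal (t / τ^b) * μ (Metric.ball y W \ Metric.ball y τ) := setLIntegral_const _ _
      _ ≤ ENNReal.ofReal (t / τ^b) * ((K:ℝ≥0∞)^n * (ENNReal.ofReal (A * (τ^d/τ^2)) * N)) := by
          gcongr
          refine (measure_mono (sdiff_subset.trans (Metric.ball_subset_ball hn))).trans ?_
          exact hK μ τ _ hτ0 (fun x => hball x τ hτ0 le_rfl) n y
      _ = ENNReal.ofReal (t / τ^b * (K^n * (A * (τ^d/τ^2)))) * N := by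
          have hp : 0 ≤ t / τ^b := by positivity
          have hq : (0:ℝ) ≤ (K:ℝ)^n := by positivity
          rw [ENNReal.ofReal_mul hp, ENNReal.ofReal_mul hq,
            ENNReal.ofReal_pow (by positivity), ENNReal.ofReal_natCast]
          ring
      _ ≤ _ := by
          gcongr ENNReal.ofReal ?_ * N
          have e : t / τ^b * τ^d/τ^2 = t^(-α/2) := by
            rw [hτ2]
            have : τ^d/τ^b = t^(-α/2) := by
              rw [← Real.rpow_natCast τ d, ← Real.rpow_sub hτ0, hτ, ← Real.rpow_mul ht.le]
              congr 1; rw [hb]; ring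
            rw [← this]; field_simp
          have e2 : t^(-α/2) ≤ s^(-α/2) := Real.rpow_le_rpow_of_nonpos hs hst (by linarith)
          calc _ = A * K^n * (t / τ^b * τ^d/τ^2) := by ring
            _ ≤ _ := by rw [e]; gcongr
  calc _ ≤ ∫⁻ z in Metric.ball y τ ∪ (Metric.ball y W \ Metric.ball y τ),
          ENNReal.ofReal (eta d α s (z - y)) ∂μ := by
        apply lintegral_mono_set
        rw [union_sdiff_self]; exact subset_union_right
    _ ≤ _ := lintegral_union_le _ _ _
    _ ≤ ENNReal.ofReal (2 * A * 2^b * s^(-α/2)) * N + ENNReal.ofReal (A * (K:ℝ)^n * s^(-α/2)) * N :=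
        add_le_add h1 h2
    _ = ENNReal.ofReal (2 * A * 2^b * s^(-α/2) + A * (K:ℝ)^n * s^(-α/2)) * N := by
        rw [ENNReal.ofReal_add (by positivity) (by positivity), add_mul]
    _ ≤ _ := by
        gcongr ENNReal.ofReal ?_ * N
        have hKn : (1:ℝ) ≤ (K:ℝ)^n := one_le_pow₀ (by exact_mod_cast hK1)
        have : 0 ≤ 2 * A * 2^b * s^(-α/2) := by positivity
        nlinarith

lemma aux_Gam_nonneg (d : ℕ) {a r : ℝ} (hr : 0 ≤ r) (u : EuclideanSpace ℝ (Fin d)) :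
    0 ≤ Gam d a r u := by
  unfold Gam; positivity

lemma aux_eta_nonneg (d : ℕ) {α r : ℝ} (hr : 0 ≤ r) (u : EuclideanSpace ℝ (Fin d)) :
    0 ≤ eta d α r u := by
  unfold eta; positivity

lemma aux_const {X : Type*} [MeasurableSpace X] (μ : Measure X) (I J : Set ℝ) (hIJ : I ⊆ J)
    (hI : MeasurableSet I) (c : ℝ) (f g : ℝ → X → ℝ≥0∞)
    (h : ∀ s ∈ I, ∀ z, f s z ≤ ENNReal.ofReal c * g s z) :
    ∫⁻ s in I, ∫⁻ z, f s z ∂μ ≤ ENNReal.ofReal c * ∫⁻ s in J, ∫⁻ z, g s z ∂μ := by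
  calc _ ≤ ∫⁻ s in I, ENNReal.ofReal c * ∫⁻ z, g s z ∂μ := by
        refine setLIntegral_mono' hI ?_
        intro s hs
        rw [← lintegral_const_mul' _ _ ENNReal.ofReal_ne_top]
        exact lintegral_mono (h s hs)
    _ = ENNReal.ofReal c * ∫⁻ s in I, ∫⁻ z, g s z ∂μ := lintegral_const_mul' _ _ ENNReal.ofReal_ne_top
    _ ≤ _ := by gcongr

/-- final scalar estimate in the far case -/
lemma aux_final {d : ℕ} {α : ℝ} (hα : 0 < α) (hα2 : α < 2) {a Cf A' Cs t : ℝ} (hCf : 0 < Cf)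
    (hA' : 0 < A') (ht : 0 < t) (K n : ℕ)
    (w : EuclideanSpace ℝ (Fin d)) (hw : t^((1:ℝ)/2) < ‖w‖)
    (hs : Real.exp (-(a/2) * (‖w‖/t^((1:ℝ)/2))^2) * (K:ℝ)^n *
      (2*(‖w‖/t^((1:ℝ)/2)))^((d:ℝ)+α) ≤ Cs) :
    Cf * (t ^ (-(d:ℝ)/2) * Real.exp (-(a/2) * (‖w‖^2/t))) *
      (A' * (K:ℝ)^n * (t^(1-α/2)/(1-α/2))) ≤ (Cf * A' / (1-α/2) * Cs) * eta d α t w := by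
  set τ := t^((1:ℝ)/2) with hτ
  have hτ0 : 0 < τ := by positivity
  have hτ2 : τ^2 = t := by rw [hτ, ← Real.sqrt_eq_rpow, Real.sq_sqrt ht.le]
  set b := (d:ℝ) + α with hb
  have hW : 0 < ‖w‖ := hτ0.trans hw
  set q := ‖w‖/τ with hq
  have hq0 : 0 < q := by positivity
  have hα' : 0 < 1 - α/2 := by linarith
  have hge := aux_eta_ge hα ht w (ρ := 2*‖w‖) (by linarith)
  rw [← hb] at hge
  have e1 : q^2 = ‖w‖^2/t := by rw [hq, div_pow, hτ2]
  have e2 : (2*‖w‖)^b = (2*q)^b * τ^b := by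
    rw [← Real.mul_rpow (by positivity) hτ0.le, hq]
    congr 1; field_simp
  have e3 : t ^ (-(d:ℝ)/2) * t^(1-α/2) = t / τ^b := by
    rw [← Real.rpow_add ht, hτ, ← Real.rpow_mul ht.le]
    nth_rewrite 2 [← Real.rpow_one t]
    rw [← Real.rpow_sub ht]
    congr 1; rw [hb]; ring
  rw [e1] at hs
  have hqb : 0 < (2*q)^b := by positivity
  have hτb : 0 < τ^b := by positivity
  set e := Real.exp (-(a/2) * (‖w‖^2/t)) with he
  have h5 : e * (K:ℝ)^n ≤ Cs / (2*q)^b := by rwa [le_div_iff₀ hqb]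
  have hCs : 0 ≤ Cs := le_trans (by positivity) hs
  calc _ = Cf * A' / (1-α/2) * ((t ^ (-(d:ℝ)/2) * t^(1-α/2)) * (e * (K:ℝ)^n)) := by
        field_simp
    _ ≤ Cf * A' / (1-α/2) * ((t / τ^b) * (Cs / (2*q)^b)) := by
        rw [e3]; gcongr
    _ = (Cf * A' / (1-α/2) * Cs) * (t / (2*‖w‖)^b) := by
        rw [e2]; field_simp
    _ ≤ _ := by gcongr

/-- 3P-type inequality for a Gaussian kernel against η and a measure. -/
theorem stmt3 (d : ℕ) (hd : 2 ≤ d) (α : ℝ) (hα1 : 0 < α) (hα2 : α < 2) (a : ℝ) (ha : 0 < a) :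
    ∃ C₃ : ℝ, 0 < C₃ ∧
      ∀ (μ : Measure (EuclideanSpace ℝ (Fin d))) (t : ℝ), 0 < t →
        ∀ x y : EuclideanSpace ℝ (Fin d),
          (∫⁻ s in Set.Ioc (0 : ℝ) t, ∫⁻ z,
              ENNReal.ofReal (Gam d a (t - s) (x - z) * eta d α s (z - y)) ∂μ)
            ≤ ENNReal.ofReal C₃ *
                (ENNReal.ofReal (Gam d a t (x - y)) *
                    (⨆ x' : EuclideanSpace ℝ (Fin d), ∫⁻ s in Set.Ioc (0 : ℝ) t, ∫⁻ y',
                      ENNReal.ofReal (eta d α s (x' - y')) ∂μ)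
                  + ENNReal.ofReal (eta d α t (x - y)) *
                    (⨆ x' : EuclideanSpace ℝ (Fin d), ∫⁻ s in Set.Ioc (0 : ℝ) t, ∫⁻ y',
                      ENNReal.ofReal (Gam d a s (x' - y')) ∂μ)) := by
  obtain ⟨K, hK1, hK⟩ := aux_cover d
  obtain ⟨Cf, hCf, hfar⟩ := aux_Gam_far d ha
  have hb0 : 0 < (d:ℝ) + α := by positivity
  obtain ⟨Cs, hCs, hscal⟩ := aux_scalar ha hb0 K hK1
  have hα' : 0 < 1 - α/2 := by linarith
  set A' := 2 * Real.exp (2*a) * (2 * 2^((d:ℝ)+α) + 1) with hA'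
  have hA'0 : 0 < A' := by positivity
  set C1 := 2 ^ ((d:ℝ)/2) * Real.exp a with hC1
  have hC10 : 0 < C1 := by positivity
  set CD := Cf * A' / (1-α/2) * Cs with hCD
  have hCD0 : 0 < CD := by positivity
  set C8 := (8:ℝ)^((d:ℝ)+α) with hC8
  have hC80 : 0 < C8 := by positivity
  refine ⟨C1 + C8 + CD, by positivity, ?_⟩
  intro μ t ht x y
  set M := (⨆ x' : EuclideanSpace ℝ (Fin d), ∫⁻ s in Set.Ioc (0 : ℝ) t, ∫⁻ y',
                      ENNReal.ofReal (eta d α s (x' - y')) ∂μ) with hM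
  set N := (⨆ x' : EuclideanSpace ℝ (Fin d), ∫⁻ s in Set.Ioc (0 : ℝ) t, ∫⁻ y',
                      ENNReal.ofReal (Gam d a s (x' - y')) ∂μ) with hN
  have hNx : ∀ x', ∫⁻ s in Set.Ioc (0 : ℝ) t, ∫⁻ y',
      ENNReal.ofReal (Gam d a s (x' - y')) ∂μ ≤ N := fun x' => le_iSup
        (fun x' : EuclideanSpace ℝ (Fin d) => ∫⁻ s in Set.Ioc (0 : ℝ) t, ∫⁻ y',
                      ENNReal.ofReal (Gam d a s (x' - y')) ∂μ) x'
  have hMx : ∀ x', ∫⁻ s in Set.Ioc (0 : ℝ) t, ∫⁻ y',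
      ENNReal.ofReal (eta d α s (x' - y')) ∂μ ≤ M := fun x' => le_iSup
        (fun x' : EuclideanSpace ℝ (Fin d) => ∫⁻ s in Set.Ioc (0 : ℝ) t, ∫⁻ y',
                      ENNReal.ofReal (eta d α s (x' - y')) ∂μ) x'
  have hrefl : ∫⁻ s in Set.Ioc (0 : ℝ) t, ∫⁻ z,
      ENNReal.ofReal (Gam d a (t - s) (x - z)) ∂μ ≤ N := by
    rw [aux_refl (fun s => ∫⁻ z, ENNReal.ofReal (Gam d a s (x - z)) ∂μ)]
    exact hNx x
  set τ := t^((1:ℝ)/2) with hτ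
  have hτ0 : 0 < τ := by positivity
  have hτ2 : τ^2 = t := by rw [hτ, ← Real.sqrt_eq_rpow, Real.sq_sqrt ht.le]
  have hG0 : 0 ≤ Gam d a t (x - y) := aux_Gam_nonneg d ht.le _
  have hE0 : 0 ≤ eta d α t (x - y) := aux_eta_nonneg d ht.le _
  rcases le_or_gt ‖x - y‖ τ with hw | hw
  · have p1 : ∫⁻ s in Set.Ioc (0 : ℝ) (t/2), ∫⁻ z,
        ENNReal.ofReal (Gam d a (t - s) (x - z) * eta d α s (z - y)) ∂μ ≤
        ENNReal.ofReal (C1 * Gam d a t (x - y)) * M := by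
      refine le_trans (aux_const μ _ (Set.Ioc 0 t) (Set.Ioc_subset_Ioc_right (by linarith))
        measurableSet_Ioc (C1 * Gam d a t (x - y)) _
        (fun s z => ENNReal.ofReal (eta d α s (y - z))) ?_) (by gcongr; exact hMx y)
      intro s hs z
      rw [← ENNReal.ofReal_mul (by positivity)]
      apply ENNReal.ofReal_le_ofReal
      have e : eta d α s (y - z) = eta d α s (z - y) := by unfold eta; rw [norm_sub_rev]
      rw [e]
      have := aux_eta_nonneg d (α := α) hs.1.le (z - y)
      gcongr
      exact aux_Gam_le ha ht (by linarith [hs.2]) _ _ hw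
    have p2 : ∫⁻ s in Set.Ioc (t/2) t, ∫⁻ z,
        ENNReal.ofReal (Gam d a (t - s) (x - z) * eta d α s (z - y)) ∂μ ≤
        ENNReal.ofReal (C8 * eta d α t (x - y)) * N := by
      refine le_trans (aux_const μ _ (Set.Ioc 0 t) (Set.Ioc_subset_Ioc_left (by linarith))
        measurableSet_Ioc (C8 * eta d α t (x - y)) _
        (fun s z => ENNReal.ofReal (Gam d a (t - s) (x - z))) ?_) (by gcongr)
      intro s hs z
      have hs0 : 0 < s := by linarith [hs.1]
      rw [← ENNReal.ofReal_mul (by positivity)]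
      apply ENNReal.ofReal_le_ofReal
      rw [mul_comm]
      have := aux_Gam_nonneg d (a := a) (by linarith [hs.2] : 0 ≤ t - s) (x - z)
      gcongr
      apply aux_eta_cmp hα1 hs0 hs.2 (by norm_num)
      have h1 : τ / 2 ≤ s^((1:ℝ)/2) := by
        rw [← Real.sqrt_eq_rpow]
        apply Real.le_sqrt_of_sq_le
        rw [div_pow, hτ2]; linarith [hs.1]
      have := norm_nonneg (z - y)
      linarith
    calc _ ≤ _ := lintegral_mono_set
          (Set.Ioc_subset_Ioc_union_Ioc : Set.Ioc 0 t ⊆ Set.Ioc 0 (t/2) ∪ Set.Ioc (t/2) t)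
      _ ≤ _ := lintegral_union_le _ _ _
      _ ≤ _ := add_le_add p1 p2
      _ ≤ _ := by
        rw [mul_add, ← mul_assoc, ← mul_assoc, ← ENNReal.ofReal_mul (by positivity),
          ← ENNReal.ofReal_mul (by positivity)]
        gcongr <;> linarith
  · set W := ‖x - y‖ with hW
    have hW0 : 0 < W := hτ0.trans hw
    set n := ⌈W/τ⌉₊ with hn
    have hn1 : (n:ℝ) ≤ W/τ + 1 := (Nat.ceil_lt_add_one (by positivity)).le
    have hn2 : W ≤ 2^n * τ := by
      have h1 : W/τ ≤ n := Nat.le_ceil _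
      have h2 : (n:ℝ) ≤ 2^n := by exact_mod_cast (Nat.lt_two_pow_self (n := n)).le
      rw [div_le_iff₀ hτ0] at h1
      nlinarith
    set E := Cf * (t ^ (-(d:ℝ)/2) * Real.exp (-(a/2) * (W^2/t))) with hE
    have hEpos : 0 < E := by positivity
    have hfin : E * (A' * (K:ℝ)^n * (t^(1-α/2)/(1-α/2))) ≤ CD * eta d α t (x - y) :=
      aux_final hα1 hα2 hCf hA'0 ht K n (x - y) hw (hscal _ (by positivity) n hn1)
    have pw : ∀ s ∈ Set.Ioo 0 t, ∀ z,
        ENNReal.ofReal (Gam d a (t - s) (x - z) * eta d α s (z - y)) ≤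
        ENNReal.ofReal (C8 * eta d α t (x - y)) * ENNReal.ofReal (Gam d a (t - s) (x - z)) +
        ENNReal.ofReal E * (Metric.ball y W).indicator
          (fun z => ENNReal.ofReal (eta d α s (z - y))) z := by
      intro s hs z
      have hG := aux_Gam_nonneg d (a := a) (by linarith [hs.2] : 0 ≤ t - s) (x - z)
      have hEs := aux_eta_nonneg d (α := α) hs.1.le (z - y)
      rcases le_or_gt (W/4) ‖z - y‖ with hv | hv
      · refine le_trans ?_ le_self_add
        rw [← ENNReal.ofReal_mul (by positivity)]
        apply ENNReal.ofReal_le_ofReal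
        rw [mul_comm]
        gcongr
        apply aux_eta_cmp hα1 hs.1 hs.2.le (by norm_num)
        have : 0 ≤ s^((1:ℝ)/2) := Real.rpow_nonneg hs.1.le _
        linarith
      · refine le_trans ?_ le_add_self
        rw [Set.indicator_of_mem (by rw [Metric.mem_ball, dist_eq_norm]; linarith),
          ← ENNReal.ofReal_mul hEpos.le]
        apply ENNReal.ofReal_le_ofReal
        gcongr
        apply hfar (t - s) t (by linarith [hs.2]) (by linarith [hs.1]) (x - z) W
        · rw [← hτ2]; gcongr
        · exact hW0.le
        · have : W ≤ ‖x - z‖ + ‖z - y‖ := by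
            rw [hW]; exact norm_sub_le_norm_sub_add_norm_sub x z y
          linarith
    have inner : ∀ s ∈ Set.Ioo 0 t,
        ∫⁻ z, ENNReal.ofReal (Gam d a (t - s) (x - z) * eta d α s (z - y)) ∂μ ≤
        ENNReal.ofReal (C8 * eta d α t (x - y)) *
            ∫⁻ z, ENNReal.ofReal (Gam d a (t - s) (x - z)) ∂μ +
          ENNReal.ofReal (E * (A' * (K:ℝ)^n)) * N * ENNReal.ofReal (s^(-α/2)) := by
      intro s hs
      refine (lintegral_mono (pw s hs)).trans ?_
      have hmeas : Measurable (fun z : EuclideanSpace ℝ (Fin d) =>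
          ENNReal.ofReal (C8 * eta d α t (x - y)) * ENNReal.ofReal (Gam d a (t - s) (x - z))) := by
        unfold Gam; fun_prop
      rw [lintegral_add_left hmeas, lintegral_const_mul' _ _ ENNReal.ofReal_ne_top,
        lintegral_const_mul' _ _ ENNReal.ofReal_ne_top, lintegral_indicator measurableSet_ball]
      refine add_le_add le_rfl ?_
      calc _ ≤ ENNReal.ofReal E * (ENNReal.ofReal (A' * (K:ℝ)^n * s^(-α/2)) * N) := by
            gcongr
            exact aux_far hd hα1 ha K hK1 hK μ y hs.1 hs.2.le N hNx n hn2
        _ = _ := by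
            rw [ENNReal.ofReal_mul hEpos.le,
              ENNReal.ofReal_mul (by positivity : 0 ≤ A' * (K:ℝ)^n)]
            ring
    calc _ ≤ ∫⁻ s in Set.Ioc 0 t, (ENNReal.ofReal (C8 * eta d α t (x - y)) *
            ∫⁻ z, ENNReal.ofReal (Gam d a (t - s) (x - z)) ∂μ +
          ENNReal.ofReal (E * (A' * (K:ℝ)^n)) * N * ENNReal.ofReal (s^(-α/2))) := by
          rw [← restrict_Ioo_eq_restrict_Ioc]
          exact setLIntegral_mono' measurableSet_Ioo inner
      _ = ENNReal.ofReal (C8 * eta d α t (x - y)) * (∫⁻ s in Set.Ioc 0 t,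
            ∫⁻ z, ENNReal.ofReal (Gam d a (t - s) (x - z)) ∂μ) +
          ENNReal.ofReal (E * (A' * (K:ℝ)^n)) * N * ENNReal.ofReal (t^(1-α/2)/(1-α/2)) := by
          rw [lintegral_add_right _ (by fun_prop), lintegral_const_mul' _ _ ENNReal.ofReal_ne_top,
            lintegral_const_mul _ (by fun_prop), aux_int hα2 ht]
      _ ≤ ENNReal.ofReal (C8 * eta d α t (x - y)) * N +
          ENNReal.ofReal (CD * eta d α t (x - y)) * N := by
          refine add_le_add (by gcongr) ?_
          calc _ = ENNReal.ofReal (E * (A' * (K:ℝ)^n * (t^(1-α/2)/(1-α/2)))) * N := by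
                rw [← mul_assoc E (A' * (K:ℝ)^n), ENNReal.ofReal_mul (by positivity : 0 ≤ E * (A' * (K:ℝ)^n))]
                ring
            _ ≤ _ := by gcongr
      _ = ENNReal.ofReal (C8 * eta d α t (x - y) + CD * eta d α t (x - y)) * N := by
          rw [ENNReal.ofReal_add (by positivity) (by positivity), add_mul]
      _ ≤ _ := by
          rw [mul_add, ← mul_assoc, ← mul_assoc, ← ENNReal.ofReal_mul (by positivity),
            ← ENNReal.ofReal_mul (by positivity)]
          refine le_trans ?_ le_add_self
          gcongr
          nlinarith
end

section
/- Let C ≥ 1 and λ > 0, and let p : (0,1]×ℝ^d×ℝ^d → [0,∞) be a measurable function satisfying p(t,x,y) ≤ C·( Γ_λ(t; x−y) + η(t; x−y) ) for all t ∈ (0,1] and x, y ∈ ℝ^d. Then there exists a constant M₁ > 0, depending only on d, α, C, λ, such that for every nonnegative Borel measure μ on ℝ^d and every (t,x,y) ∈ (0,1]×ℝ^d×ℝ^d, ∫₀^t ∫_{ℝ^d} p(t−s, x, z)·p_{2λ/3}(s, z, y) μ(dz) ds ≤ M₁·p_{2λ/3}(t,x,y)·N_μ^{α,λ/3}(t).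 -/
open MeasureTheory Set ENNReal

noncomputable def pc (d : ℕ) (α c t : ℝ) (x y : EuclideanSpace ℝ (Fin d)) : ℝ :=
  Gam d c t (x - y) + eta d α t (x - y)

noncomputable def Nmu (d : ℕ) (α lam : ℝ) (μ : Measure (EuclideanSpace ℝ (Fin d)))
    (t : ℝ) : ℝ≥0∞ :=
  ⨆ x : EuclideanSpace ℝ (Fin d), ∫⁻ s in Set.Ioc (0 : ℝ) t, ∫⁻ y,
    ENNReal.ofReal (Gam d lam s (x - y) + eta d α s (x - y)) ∂μ

noncomputable def GG (d : ℕ) (c t r : ℝ) : ℝ := t ^ (-(d : ℝ) / 2) * Real.exp (-c * r ^ 2 / t)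
noncomputable def EE (D t r : ℝ) : ℝ := t / (t ^ ((1 : ℝ) / 2) + r) ^ D

lemma GG_pos (d : ℕ) (c t r : ℝ) (ht : 0 < t) : 0 < GG d c t r := by
  unfold GG; positivity

lemma EE_pos (D t r : ℝ) (ht : 0 < t) (hr : 0 ≤ r) : 0 < EE D t r := by
  unfold EE
  have : 0 < t ^ ((1 : ℝ) / 2) := by positivity
  positivity

lemma GG_mono (d : ℕ) (c c' t r : ℝ) (ht : 0 < t) (h : c' ≤ c) : GG d c t r ≤ GG d c' t r := by
  unfold GG
  gcongr

/-- comparing time prefactors -/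
lemma pre_le (d : ℕ) (t u : ℝ) (ht : 0 < t) (hu : t / 4 ≤ u) :
    u ^ (-(d : ℝ) / 2) ≤ 4 ^ ((d : ℝ) / 2) * t ^ (-(d : ℝ) / 2) := by
  have h1 : u ^ (-(d : ℝ) / 2) ≤ (t / 4) ^ (-(d : ℝ) / 2) := by
    apply Real.rpow_le_rpow_of_nonpos (by positivity) hu
    have : (0 : ℝ) ≤ d := by positivity
    linarith
  refine h1.trans (le_of_eq ?_)
  rw [Real.div_rpow ht.le (by norm_num), neg_div, Real.rpow_neg (x := 4) (by norm_num)]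
  field_simp

lemma EE_le (D t v b w : ℝ) (hD : 0 < D) (hv : 0 < v) (hvt : v ≤ t) (hb : 0 ≤ b) (hw : 0 ≤ w)
    (h : (t ^ ((1 : ℝ) / 2) + w) / 4 ≤ v ^ ((1 : ℝ) / 2) + b) :
    EE D v b ≤ 4 ^ D * EE D t w := by
  have ht : 0 < t := by linarith
  have h0 : 0 < t ^ ((1 : ℝ) / 2) := by positivity
  unfold EE
  have h1 : ((t ^ ((1 : ℝ) / 2) + w) / 4) ^ D ≤ (v ^ ((1 : ℝ) / 2) + b) ^ D :=
    Real.rpow_le_rpow (by positivity) h hD.le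
  calc v / (v ^ ((1 : ℝ) / 2) + b) ^ D ≤ t / ((t ^ ((1 : ℝ) / 2) + w) / 4) ^ D := by
        gcongr
    _ = _ := by
        rw [Real.div_rpow (by positivity) (by norm_num)]
        field_simp

lemma EE_EE (D t u v a b w : ℝ) (hD : 0 < D) (hu : 0 < u) (hv : 0 < v) (ht : t = u + v)
    (ha : 0 ≤ a) (hb : 0 ≤ b) (hw : 0 ≤ w) (hab : w ≤ a + b) :
    EE D u a * EE D v b ≤ 4 ^ D * EE D t w * (EE D u a + EE D v b) := by
  have ht0 : 0 < t := by linarith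
  have e1 := EE_pos D u a hu ha
  have e2 := EE_pos D v b hv hb
  have e3 := EE_pos D t w ht0 hw
  have h4 : (0 : ℝ) < 4 ^ D := by positivity
  have hs : t ^ ((1 : ℝ) / 2) ≤ u ^ ((1 : ℝ) / 2) + v ^ ((1 : ℝ) / 2) := by
    rw [ht]; exact Real.rpow_add_le_add_rpow hu.le hv.le (by norm_num) (by norm_num)
  have hu0 : 0 < u ^ ((1 : ℝ) / 2) := by positivity
  have hv0 : 0 < v ^ ((1 : ℝ) / 2) := by positivity
  by_cases h : (t ^ ((1 : ℝ) / 2) + w) / 4 ≤ v ^ ((1 : ℝ) / 2) + b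
  · have := EE_le D t v b w hD hv (by linarith) hb hw h
    nlinarith [mul_le_mul_of_nonneg_left this e1.le, mul_pos (mul_pos h4 e3) e2]
  · have := EE_le D t u a w hD hu (by linarith) ha hw (by linarith)
    nlinarith [mul_le_mul_of_nonneg_left this e2.le, mul_pos (mul_pos h4 e3) e1]

lemma titu (u v a b w : ℝ) (A B t : ℝ) (hu : 0 < u) (hv : 0 < v) (hA : 0 < A) (hB : 0 < B)
    (ht : 0 < t) (hw : 0 ≤ w) (hab : w ≤ a + b) (h : u / A + v / B ≤ t) :
    w ^ 2 / t ≤ A * a ^ 2 / u + B * b ^ 2 / v := by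
  have h1 : (a + b) ^ 2 / (u / A + v / B) ≤ a ^ 2 / (u / A) + b ^ 2 / (v / B) := by
    have hp : 0 < u / A := by positivity
    have hq : 0 < v / B := by positivity
    generalize u / A = P at *
    generalize v / B = Q at *
    rw [div_add_div _ _ hp.ne' hq.ne', div_le_div_iff₀ (by positivity) (by positivity)]
    nlinarith [sq_nonneg (a * Q - b * P)]
  calc w ^ 2 / t ≤ (a + b) ^ 2 / (u / A + v / B) := by gcongr
    _ ≤ _ := h1
    _ = _ := by field_simp

lemma GG_GG (d : ℕ) (k t u v a b w : ℝ) (hk : 0 < k) (hu : 0 < u) (hv : 0 < v) (ht : t = u + v)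
    (hw : 0 ≤ w) (hab : w ≤ a + b) :
    GG d (3 * k / 2) u a * GG d k v b ≤
      4 ^ ((d : ℝ) / 2) * GG d k t w * (GG d (k / 2) u a + GG d (k / 2) v b) := by
  have ht0 : 0 < t := by linarith
  have e1 := GG_pos d (k / 2) u a hu
  have e2 := GG_pos d (k / 2) v b hv
  have e3 := GG_pos d k t w ht0
  have h4 : (0 : ℝ) < 4 ^ ((d : ℝ) / 2) := by positivity
  by_cases h : t / 4 ≤ v
  · have key : GG d (3 * k / 2) u a * GG d k v b ≤
        4 ^ ((d : ℝ) / 2) * GG d k t w * GG d (k / 2) u a := by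
      have hp := pre_le d t v ht0 h
      have he : Real.exp (-(3 * k / 2) * a ^ 2 / u) * Real.exp (-k * b ^ 2 / v) ≤
          Real.exp (-k * w ^ 2 / t) * Real.exp (-(k / 2) * a ^ 2 / u) := by
        rw [← Real.exp_add, ← Real.exp_add]
        apply Real.exp_le_exp.2
        have := mul_le_mul_of_nonneg_left
          (titu u v a b w 1 1 t hu hv one_pos one_pos ht0 hw hab (by simp [ht])) hk.le
        have e : ∀ c x y : ℝ, c * x / y = c * (x / y) := fun c x y => mul_div_assoc c x y
        simp only [e] at *
        linarith
      unfold GG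
      calc _ = u ^ (-(d : ℝ) / 2) * v ^ (-(d : ℝ) / 2) *
            (Real.exp (-(3 * k / 2) * a ^ 2 / u) * Real.exp (-k * b ^ 2 / v)) := by ring
        _ ≤ u ^ (-(d : ℝ) / 2) * (4 ^ ((d : ℝ) / 2) * t ^ (-(d : ℝ) / 2)) *
            (Real.exp (-k * w ^ 2 / t) * Real.exp (-(k / 2) * a ^ 2 / u)) := by gcongr
        _ = _ := by ring
    nlinarith [mul_pos (mul_pos h4 e3) e2]
  · have key : GG d (3 * k / 2) u a * GG d k v b ≤
        4 ^ ((d : ℝ) / 2) * GG d k t w * GG d (k / 2) v b := by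
      have hp := pre_le d t u ht0 (by linarith)
      have he : Real.exp (-(3 * k / 2) * a ^ 2 / u) * Real.exp (-k * b ^ 2 / v) ≤
          Real.exp (-k * w ^ 2 / t) * Real.exp (-(k / 2) * b ^ 2 / v) := by
        rw [← Real.exp_add, ← Real.exp_add]
        apply Real.exp_le_exp.2
        have := mul_le_mul_of_nonneg_left
          (titu u v a b w (3 / 2) (1 / 2) t hu hv (by norm_num) (by norm_num) ht0 hw hab
            (by linarith)) hk.le
        have e : ∀ c x y : ℝ, c * x / y = c * (x / y) := fun c x y => mul_div_assoc c x y
        simp only [e] at *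
        linarith
      unfold GG
      calc _ = u ^ (-(d : ℝ) / 2) * v ^ (-(d : ℝ) / 2) *
            (Real.exp (-(3 * k / 2) * a ^ 2 / u) * Real.exp (-k * b ^ 2 / v)) := by ring
        _ ≤ (4 ^ ((d : ℝ) / 2) * t ^ (-(d : ℝ) / 2)) * v ^ (-(d : ℝ) / 2) *
            (Real.exp (-k * w ^ 2 / t) * Real.exp (-(k / 2) * b ^ 2 / v)) := by gcongr
        _ = _ := by ring
    nlinarith [mul_pos (mul_pos h4 e3) e1]

lemma rpow_exp_bound (q c y : ℝ) (hq : 0 < q) (hc : 0 < c) (hy : 0 ≤ y) :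
    y ^ q * Real.exp (-c * y) ≤ (q / c) ^ q := by
  have h1 : c * y / q ≤ Real.exp (c * y / q) := by
    have := Real.add_one_le_exp (c * y / q); linarith
  have h2 : (c * y / q) ^ q ≤ Real.exp (c * y) := by
    calc _ ≤ (Real.exp (c * y / q)) ^ q := Real.rpow_le_rpow (by positivity) h1 hq.le
      _ = _ := by rw [← Real.exp_mul]; congr 1; field_simp
  have h3 : y = (q / c) * (c * y / q) := by field_simp
  have h4 : y ^ q = (q / c) ^ q * (c * y / q) ^ q := by
    conv_lhs => rw [h3]
    rw [Real.mul_rpow (by positivity) (by positivity)]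
  rw [h4, neg_mul, Real.exp_neg]
  have := Real.exp_pos (c * y)
  rw [← div_eq_mul_inv, div_le_iff₀ this]
  gcongr

/-- constant for the mixed term -/
noncomputable def KK (d : ℕ) (D k : ℝ) : ℝ :=
  4 ^ D + 4 ^ ((d : ℝ) / 2) * Real.exp k +
    2 ^ (D - 2) * Real.exp (k / 2) * ((D - 1) / (k / 16)) ^ (D - 1)

lemma KK_pos (d : ℕ) (D k : ℝ) (hD : 2 < D) (hk : 0 < k) : 0 < KK d D k := by
  unfold KK
  have : 0 < (D - 1) / (k / 16) := div_pos (by linarith) (by linarith)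
  positivity

set_option maxHeartbeats 1000000 in
lemma GG_EE (d : ℕ) (D k t u v a b w : ℝ) (hD : 2 < D) (hk : 0 < k) (hu : 0 < u) (hv : 0 < v)
    (ht : t = u + v) (ha : 0 ≤ a) (hb : 0 ≤ b) (hw : 0 ≤ w) (hab : w ≤ a + b) :
    GG d k u a * EE D v b ≤
      KK d D k * (GG d k t w + EE D t w) * (GG d (k / 2) u a + EE D v b) := by
  have ht0 : 0 < t := by linarith
  have e1 := GG_pos d (k / 2) u a hu
  have e1' := GG_pos d k u a hu
  have e1m := GG_mono d k (k / 2) u a hu (by linarith)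
  have e2 := EE_pos D v b hv hb
  have e3 := GG_pos d k t w ht0
  have e4 := EE_pos D t w ht0 hw
  have hq : 0 < (D - 1) / (k / 16) := div_pos (by linarith) (by linarith)
  have c1 : (0 : ℝ) < 4 ^ D := by positivity
  have c2 : (0 : ℝ) < 4 ^ ((d : ℝ) / 2) * Real.exp k := by positivity
  have c3 : (0 : ℝ) < 2 ^ (D - 2) * Real.exp (k / 2) * ((D - 1) / (k / 16)) ^ (D - 1) := by
    positivity
  -- reduce to one of two product bounds
  have red1 : ∀ c, 0 ≤ c → c ≤ KK d D k →
      GG d k u a * EE D v b ≤ c * EE D t w * GG d (k / 2) u a →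
      GG d k u a * EE D v b ≤
        KK d D k * (GG d k t w + EE D t w) * (GG d (k / 2) u a + EE D v b) := by
    intro c hc hcK h
    have hK0 : 0 ≤ KK d D k := hc.trans hcK
    refine h.trans (mul_le_mul (mul_le_mul hcK (by linarith) (by linarith) hK0) (by linarith)
      (by linarith) (mul_nonneg hK0 (by linarith)))
  have red2 : ∀ c, 0 ≤ c → c ≤ KK d D k →
      GG d k u a * EE D v b ≤ c * GG d k t w * EE D v b →
      GG d k u a * EE D v b ≤
        KK d D k * (GG d k t w + EE D t w) * (GG d (k / 2) u a + EE D v b) := by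
    intro c hc hcK h
    have hK0 : 0 ≤ KK d D k := hc.trans hcK
    refine h.trans (mul_le_mul (mul_le_mul hcK (by linarith) (by linarith) hK0) (by linarith)
      (by linarith) (mul_nonneg hK0 (by linarith)))
  set R := t ^ ((1 : ℝ) / 2) + w with hR
  set r := v ^ ((1 : ℝ) / 2) + b with hr
  have ht1 : 0 < t ^ ((1 : ℝ) / 2) := by positivity
  have hv1 : 0 < v ^ ((1 : ℝ) / 2) := by positivity
  have ht2 : (t ^ ((1 : ℝ) / 2)) ^ 2 = t := by
    rw [← Real.rpow_natCast, ← Real.rpow_mul ht0.le]; norm_num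
  have hv2 : (v ^ ((1 : ℝ) / 2)) ^ 2 = v := by
    rw [← Real.rpow_natCast, ← Real.rpow_mul hv.le]; norm_num
  have hR0 : 0 < R := by positivity
  have hr0 : 0 < r := by positivity
  by_cases hA : R / 4 ≤ r
  · apply red1 (4 ^ D) c1.le (by unfold KK; linarith)
    have := EE_le D t v b w (by linarith) hv (by linarith) hb hw hA
    calc GG d k u a * EE D v b ≤ GG d (k / 2) u a * (4 ^ D * EE D t w) := by gcongr
      _ = _ := by ring
  by_cases hB : r * (2 * R) < t
  · apply red2 _ c2.le (by unfold KK; linarith)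
    gcongr
    have hbw : 2 * (w * b) ≤ t := by
      nlinarith [mul_nonneg hw hv1.le, mul_nonneg ht1.le hb, mul_pos ht1 hv1]
    have haw : w ^ 2 - t ≤ a ^ 2 := by
      by_cases hwb : b ≤ w
      · nlinarith [mul_self_le_mul_self (sub_nonneg.2 hwb) (show w - b ≤ a by linarith)]
      · nlinarith
    have hvt : v ≤ t / 4 := by
      have : v ^ ((1 : ℝ) / 2) * (2 * t ^ ((1 : ℝ) / 2)) < t :=
        lt_of_le_of_lt (by gcongr <;> linarith) hB
      nlinarith
    have hp := pre_le d t u ht0 (by linarith)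
    have he : Real.exp (-k * a ^ 2 / u) ≤ Real.exp k * Real.exp (-k * w ^ 2 / t) := by
      rw [← Real.exp_add]
      apply Real.exp_le_exp.2
      have h1 : a ^ 2 / t ≤ a ^ 2 / u := by gcongr; linarith
      have h2 : w ^ 2 / t - 1 ≤ a ^ 2 / t := by
        rw [← div_self ht0.ne', ← sub_div]; gcongr
      have := mul_le_mul_of_nonneg_left (h2.trans h1) hk.le
      have e : ∀ c x y : ℝ, c * x / y = c * (x / y) := fun c x y => mul_div_assoc c x y
      simp only [e]
      linarith
    unfold GG
    calc _ ≤ (4 ^ ((d : ℝ) / 2) * t ^ (-(d : ℝ) / 2)) *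
          (Real.exp k * Real.exp (-k * w ^ 2 / t)) := by gcongr
      _ = _ := by ring
  · apply red1 _ c3.le (by unfold KK; linarith)
    push Not at hA hB
    have hE : EE D v b ≤ (2 * R / t) ^ (D - 2) := by
      have h1 : EE D v b ≤ r ^ (2 - D) := by
        unfold EE
        rw [← hr, Real.rpow_sub hr0]
        gcongr
        rw [Real.rpow_two, ← hv2]
        gcongr
        linarith
      have h2 : r ^ (2 - D) ≤ (t / (2 * R)) ^ (2 - D) := by
        apply Real.rpow_le_rpow_of_nonpos (by positivity) _ (by linarith)
        rw [div_le_iff₀ (by positivity)]; exact hB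
      have h3 : (t / (2 * R)) ^ (2 - D) = (2 * R / t) ^ (D - 2) := by
        rw [show 2 - D = -(D - 2) by ring, Real.rpow_neg (by positivity),
          ← Real.inv_rpow (by positivity), inv_div]
      linarith
    have hG : GG d k u a ≤ GG d (k / 2) u a *
        (Real.exp (k / 2) * Real.exp (-(k / 16) * (R ^ 2 / t))) := by
      unfold GG
      rw [mul_assoc, ← Real.exp_add, ← Real.exp_add]
      gcongr
      have hRa : R ≤ 2 * a + 2 * t ^ ((1 : ℝ) / 2) := by linarith
      have hR2 : R ^ 2 ≤ 8 * a ^ 2 + 8 * t := by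
        nlinarith [sq_nonneg (a - t ^ ((1 : ℝ) / 2)), mul_self_le_mul_self hR0.le hRa]
      have h1 : a ^ 2 / t ≤ a ^ 2 / u := by gcongr; linarith
      have h2 : R ^ 2 / t ≤ 8 * (a ^ 2 / t) + 8 := by
        rw [div_le_iff₀ ht0]; field_simp; linarith
      have e : ∀ c x y : ℝ, c * x / y = c * (x / y) := fun c x y => mul_div_assoc c x y
      simp only [e]
      have h3 := mul_le_mul_of_nonneg_left (h2.trans (add_le_add_left
        (mul_le_mul_of_nonneg_left h1 (by norm_num : (0 : ℝ) ≤ 8)) 8)) hk.le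
      linarith
    have hy := rpow_exp_bound (D - 1) (k / 16) (R ^ 2 / t) (by linarith) (by linarith)
      (by positivity)
    have hid : (2 * R / t) ^ (D - 2) = 2 ^ (D - 2) * (R ^ 2 / t) ^ (D - 1) * (t / R ^ D) := by
      rw [Real.div_rpow (by positivity) ht0.le, Real.mul_rpow (by norm_num) hR0.le,
        Real.div_rpow (by positivity) ht0.le, ← Real.rpow_natCast R 2, ← Real.rpow_mul hR0.le,
        show D - 1 = (D - 2) + 1 by ring, Real.rpow_add_one ht0.ne',
        show ((2 : ℕ) : ℝ) * (D - 2 + 1) = (D - 2) + D by push_cast; ring, Real.rpow_add hR0]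
      field_simp
    calc GG d k u a * EE D v b
        ≤ (GG d (k / 2) u a * (Real.exp (k / 2) * Real.exp (-(k / 16) * (R ^ 2 / t)))) *
            (2 * R / t) ^ (D - 2) := by gcongr
      _ = GG d (k / 2) u a * Real.exp (k / 2) * 2 ^ (D - 2) * (t / R ^ D) *
          ((R ^ 2 / t) ^ (D - 1) * Real.exp (-(k / 16) * (R ^ 2 / t))) := by rw [hid]; ring
      _ ≤ GG d (k / 2) u a * Real.exp (k / 2) * 2 ^ (D - 2) * (t / R ^ D) *
          ((D - 1) / (k / 16)) ^ (D - 1) := by gcongr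
      _ = _ := by unfold EE; rw [← hR]; ring

/-- pointwise 3P inequality -/
lemma three_P (d : ℕ) (D k t u v a b w : ℝ) (hD : 2 < D) (hk : 0 < k) (hu : 0 < u) (hv : 0 < v)
    (ht : t = u + v) (ha : 0 ≤ a) (hb : 0 ≤ b) (hw : 0 ≤ w) (hab : w ≤ a + b) :
    (GG d (3 * k / 2) u a + EE D u a) * (GG d k v b + EE D v b) ≤
      (4 * KK d D k) * (GG d k t w + EE D t w) *
        ((GG d (k / 2) u a + EE D u a) + (GG d (k / 2) v b + EE D v b)) := by
  have ht0 : 0 < t := by linarith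
  have hK := KK_pos d D k hD hk
  have e1 := GG_pos d (k / 2) u a hu
  have e2 := GG_pos d (k / 2) v b hv
  have e3 := GG_pos d k t w ht0
  have e4 := EE_pos D u a hu ha
  have e5 := EE_pos D v b hv hb
  have e6 := EE_pos D t w ht0 hw
  have hq : 0 < (D - 1) / (k / 16) := div_pos (by linarith) (by linarith)
  have c3 : (0 : ℝ) < 2 ^ (D - 2) * Real.exp (k / 2) * ((D - 1) / (k / 16)) ^ (D - 1) := by
    positivity
  have c2 : (0 : ℝ) < 4 ^ ((d : ℝ) / 2) := by positivity
  have c1 : (0 : ℝ) < 4 ^ D := by positivity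
  have k1 : (4 : ℝ) ^ D ≤ KK d D k := by
    unfold KK
    have : 0 < 4 ^ ((d : ℝ) / 2) * Real.exp k := by positivity
    linarith
  have k2 : (4 : ℝ) ^ ((d : ℝ) / 2) ≤ KK d D k := by
    unfold KK
    have : 4 ^ ((d : ℝ) / 2) * 1 ≤ 4 ^ ((d : ℝ) / 2) * Real.exp k := by
      gcongr; exact Real.one_le_exp hk.le
    linarith
  have b1 := GG_GG d k t u v a b w hk hu hv ht hw hab
  have b2 := EE_EE D t u v a b w (by linarith) hu hv ht ha hb hw hab
  have b3 := GG_EE d D k t u v a b w hD hk hu hv ht ha hb hw hab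
  have b4 := GG_EE d D k t v u b a w hD hk hv hu (by linarith) hb ha hw (by linarith)
  have m := GG_mono d (3 * k / 2) k u a hu (by linarith)
  set S := (GG d (k / 2) u a + EE D u a) + (GG d (k / 2) v b + EE D v b) with hS
  set P := GG d k t w + EE D t w with hP
  have b1' : GG d (3 * k / 2) u a * GG d k v b ≤ KK d D k * P * S := by
    refine b1.trans ?_
    gcongr <;> linarith
  have b2' : EE D u a * EE D v b ≤ KK d D k * P * S := by
    refine b2.trans ?_
    gcongr <;> linarith
  have b3' : GG d (3 * k / 2) u a * EE D v b ≤ KK d D k * P * S := by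
    refine (mul_le_mul_of_nonneg_right m e5.le).trans (b3.trans ?_)
    gcongr; linarith
  have b4' : EE D u a * GG d k v b ≤ KK d D k * P * S := by
    rw [mul_comm]
    refine b4.trans ?_
    gcongr; linarith
  linarith

lemma meas_pc (d : ℕ) (α c : ℝ) (x : EuclideanSpace ℝ (Fin d)) :
    Measurable (fun q : ℝ × EuclideanSpace ℝ (Fin d) =>
      ENNReal.ofReal (Gam d c q.1 (x - q.2) + eta d α q.1 (x - q.2))) := by
  unfold Gam eta
  fun_prop

lemma Nmu_sfinite (d : ℕ) (α c : ℝ) (μ : Measure (EuclideanSpace ℝ (Fin d)))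
    (t : ℝ) (ht : 0 < t) (h : Nmu d α c μ t ≠ ∞) : SFinite μ := by
  have h0 : ∫⁻ s in Set.Ioc (0 : ℝ) t, ∫⁻ y,
      ENNReal.ofReal (Gam d c s (0 - y) + eta d α s (0 - y)) ∂μ ≠ ∞ :=
    ne_top_of_le_ne_top h (le_iSup (fun x : EuclideanSpace ℝ (Fin d) =>
      ∫⁻ s in Set.Ioc (0 : ℝ) t, ∫⁻ y,
        ENNReal.ofReal (Gam d c s (x - y) + eta d α s (x - y)) ∂μ) 0)
  obtain ⟨s, hs, hfin⟩ : ∃ s ∈ Set.Ioc (0 : ℝ) t, ∫⁻ y,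
      ENNReal.ofReal (Gam d c s (0 - y) + eta d α s (0 - y)) ∂μ ≠ ∞ := by
    by_contra! hc
    apply h0
    rw [setLIntegral_congr_fun measurableSet_Ioc hc, setLIntegral_const, Real.volume_Ioc]
    apply ENNReal.top_mul
    simpa using ht
  set f : EuclideanSpace ℝ (Fin d) → ℝ≥0∞ := fun y =>
    ENNReal.ofReal (Gam d c s (0 - y) + eta d α s (0 - y)) with hf
  have hfm : Measurable f := (meas_pc d α c 0).comp (measurable_const.prodMk measurable_id)
  haveI : IsFiniteMeasure (μ.withDensity f) := isFiniteMeasure_withDensity hfin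
  have hpos : ∀ y, f y ≠ 0 := by
    intro y
    have h1 := GG_pos d c s ‖0 - y‖ hs.1
    have h2 := EE_pos (d + α) s ‖0 - y‖ hs.1 (norm_nonneg _)
    have : 0 < Gam d c s (0 - y) + eta d α s (0 - y) := add_pos h1 h2
    simpa [hf] using this
  have := withDensity_inv_same (μ := μ) hfm (Filter.Eventually.of_forall hpos)
    (Filter.Eventually.of_forall fun y => ENNReal.ofReal_ne_top)
  rw [← this]
  infer_instance

lemma refl_int (F : ℝ → ℝ≥0∞) (t : ℝ) :
    ∫⁻ s in Set.Ioo (0 : ℝ) t, F (t - s) = ∫⁻ s in Set.Ioo (0 : ℝ) t, F s := by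
  rw [← lintegral_indicator measurableSet_Ioo, ← lintegral_indicator measurableSet_Ioo,
    ← lintegral_sub_left_eq_self (fun s => (Set.Ioo (0 : ℝ) t).indicator F s) t]
  congr 1
  ext s
  simp only [Set.indicator, Set.mem_Ioo]
  congr 1
  apply propext
  constructor <;> rintro ⟨h1, h2⟩ <;> constructor <;> linarith

/-- integral 3P inequality for the heat kernel `p` against a measure μ. -/
theorem stmt4 (d : ℕ) (hd : 2 ≤ d) (α : ℝ) (hα1 : 0 < α) (hα2 : α < 2)
    (C lam : ℝ) (hC : 1 ≤ C) (hlam : 0 < lam) :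
    ∃ M₁ : ℝ, 0 < M₁ ∧
      ∀ p : ℝ → EuclideanSpace ℝ (Fin d) → EuclideanSpace ℝ (Fin d) → ℝ,
        Measurable (fun q : ℝ × EuclideanSpace ℝ (Fin d) × EuclideanSpace ℝ (Fin d) =>
          p q.1 q.2.1 q.2.2) →
        (∀ t ∈ Set.Ioc (0 : ℝ) 1, ∀ x y, 0 ≤ p t x y) →
        (∀ t ∈ Set.Ioc (0 : ℝ) 1, ∀ x y,
          p t x y ≤ C * (Gam d lam t (x - y) + eta d α t (x - y))) →
        ∀ (μ : Measure (EuclideanSpace ℝ (Fin d))),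
          ∀ t ∈ Set.Ioc (0 : ℝ) 1, ∀ x y : EuclideanSpace ℝ (Fin d),
            (∫⁻ s in Set.Ioc (0 : ℝ) t, ∫⁻ z,
                ENNReal.ofReal (p (t - s) x z * pc d α (2 * lam / 3) s z y) ∂μ)
              ≤ ENNReal.ofReal (M₁ * pc d α (2 * lam / 3) t x y) *
                  Nmu d α (lam / 3) μ t := by
  have hD : 2 < (d : ℝ) + α := by
    have : (2 : ℝ) ≤ d := by exact_mod_cast hd
    linarith
  have hK := KK_pos d (d + α) (2 * lam / 3) hD (by linarith)
  set K := KK d (d + α) (2 * lam / 3) with hKdef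
  refine ⟨2 * (C * (4 * K)), by positivity, ?_⟩
  intro p _ hp0 hp μ t ht x y
  have ht0 : 0 < t := ht.1
  have hpc : 0 < pc d α (2 * lam / 3) t x y :=
    add_pos (GG_pos d _ t ‖x - y‖ ht0) (EE_pos (d + α) t ‖x - y‖ ht0 (norm_nonneg _))
  by_cases hN : Nmu d α (lam / 3) μ t = ∞
  · rw [hN, ENNReal.mul_top]
    · exact le_top
    · have : 0 < 2 * (C * (4 * K)) * pc d α (2 * lam / 3) t x y := by positivity
      simpa using this
  haveI := Nmu_sfinite d α (lam / 3) μ t ht0 hN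
  set A : EuclideanSpace ℝ (Fin d) → ℝ → ℝ≥0∞ := fun x s => ∫⁻ z,
    ENNReal.ofReal (Gam d (lam / 3) s (x - z) + eta d α s (x - z)) ∂μ with hA
  have hAm : ∀ x, Measurable (A x) := fun x => (meas_pc d α (lam / 3) x).lintegral_prod_right'
  have hAN : ∀ x, ∫⁻ s in Set.Ioo (0 : ℝ) t, A x s ≤ Nmu d α (lam / 3) μ t := by
    intro x
    rw [Measure.restrict_congr_set Ioo_ae_eq_Ioc]
    exact le_iSup (fun x => ∫⁻ s in Set.Ioc (0 : ℝ) t, A x s) x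
  have hbound : ∀ s ∈ Set.Ioo (0 : ℝ) t, (∫⁻ z,
      ENNReal.ofReal (p (t - s) x z * pc d α (2 * lam / 3) s z y) ∂μ) ≤
      ENNReal.ofReal (C * (4 * K) * pc d α (2 * lam / 3) t x y) * (A x (t - s) + A y s) := by
    intro s hs
    have hu : 0 < t - s := by linarith [hs.2]
    have hm : ∀ x s, Measurable (fun z =>
        ENNReal.ofReal (Gam d (lam / 3) s (x - z) + eta d α s (x - z))) := fun x s =>
      (meas_pc d α (lam / 3) x).comp (measurable_const.prodMk measurable_id)
    rw [hA]
    dsimp only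
    rw [← lintegral_add_left (hm _ _), ← lintegral_const_mul' _ _ ENNReal.ofReal_ne_top]
    apply lintegral_mono
    intro z
    dsimp only
    have g1 : 0 < Gam d (lam / 3) (t - s) (x - z) + eta d α (t - s) (x - z) :=
      add_pos (GG_pos d _ _ ‖x - z‖ hu) (EE_pos (d + α) _ ‖x - z‖ hu (norm_nonneg _))
    have g2 : 0 < Gam d (lam / 3) s (y - z) + eta d α s (y - z) :=
      add_pos (GG_pos d _ _ ‖y - z‖ hs.1) (EE_pos (d + α) _ ‖y - z‖ hs.1 (norm_nonneg _))
    rw [← ENNReal.ofReal_add g1.le g2.le, ← ENNReal.ofReal_mul (by positivity)]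
    apply ENNReal.ofReal_le_ofReal
    have g3 : 0 < pc d α (2 * lam / 3) s z y :=
      add_pos (GG_pos d _ _ ‖z - y‖ hs.1) (EE_pos (d + α) _ ‖z - y‖ hs.1 (norm_nonneg _))
    have hpp := hp (t - s) ⟨hu, by linarith [hs.1, ht.2]⟩ x z
    have h3 := three_P d (d + α) (2 * lam / 3) t (t - s) s ‖x - z‖ ‖z - y‖ ‖x - y‖ hD
      (by linarith) hu hs.1 (by ring) (norm_nonneg _) (norm_nonneg _) (norm_nonneg _)
      (norm_sub_le_norm_sub_add_norm_sub x z y)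
    rw [show 3 * (2 * lam / 3) / 2 = lam by ring, show 2 * lam / 3 / 2 = lam / 3 by ring] at h3
    have h4 : (Gam d lam (t - s) (x - z) + eta d α (t - s) (x - z)) *
        pc d α (2 * lam / 3) s z y ≤ (4 * K) * pc d α (2 * lam / 3) t x y *
        ((Gam d (lam / 3) (t - s) (x - z) + eta d α (t - s) (x - z)) +
          (Gam d (lam / 3) s (y - z) + eta d α s (y - z))) := by
      have e1 : Gam d (lam / 3) s (y - z) = GG d (lam / 3) s ‖z - y‖ := by
        rw [norm_sub_rev]; rfl
      have e2 : eta d α s (y - z) = EE (d + α) s ‖z - y‖ := by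
        rw [norm_sub_rev]; rfl
      rw [e1, e2]
      exact h3
    calc _ ≤ C * (Gam d lam (t - s) (x - z) + eta d α (t - s) (x - z)) *
          pc d α (2 * lam / 3) s z y := by gcongr
      _ = C * ((Gam d lam (t - s) (x - z) + eta d α (t - s) (x - z)) *
          pc d α (2 * lam / 3) s z y) := by ring
      _ ≤ C * _ := mul_le_mul_of_nonneg_left h4 (by linarith)
      _ = _ := by ring
  rw [← Measure.restrict_congr_set Ioo_ae_eq_Ioc]
  refine (setLIntegral_mono' measurableSet_Ioo hbound).trans ?_
  have hAm' : Measurable (fun s => A x (t - s)) :=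
    (hAm x).comp (measurable_const.sub measurable_id)
  rw [lintegral_const_mul' _ _ ENNReal.ofReal_ne_top, lintegral_add_left hAm', refl_int (A x) t]
  calc _ ≤ ENNReal.ofReal (C * (4 * K) * pc d α (2 * lam / 3) t x y) *
        (Nmu d α (lam / 3) μ t + Nmu d α (lam / 3) μ t) := by
        gcongr
        · exact hAN x
        · exact hAN y
    _ = _ := by
        rw [← two_mul, ← mul_assoc, mul_comm _ (2 : ℝ≥0∞),
          show 2 * (C * (4 * K)) * pc d α (2 * lam / 3) t x y =
            2 * (C * (4 * K) * pc d α (2 * lam / 3) t x y) by ring,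
          ENNReal.ofReal_mul (p := 2) (by norm_num)]
        norm_num
end

section
/- Let C ≥ 1 and λ > 0, and let p : (0,1]×ℝ^d×ℝ^d → [0,∞) be a measurable function satisfying p(t,x,y) ≤ C·( Γ_λ(t; x−y) + η(t; x−y) ) for all t ∈ (0,1] and x, y ∈ ℝ^d. Then there exists a constant M₂ > 0, depending only on d, α, C, λ, such that for every bounded measurable function G : ℝ^d×ℝ^d → [0,∞) and every (t,x,y) ∈ (0,1]×ℝ^d×ℝ^d, ∫₀^t ∫_{ℝ^d×ℝ^d} p(t−s, x, z)·p_{2λ/3}(s, w, y)·G(z,w)/|z−w|^{d+α} dz dw ds ≤ M₂·p_{2λ/3}(t,x,y)·( N_G^{α,λ/3}(t) + ‖G‖_∞·𝟙_{\{|x−y| > t^{1/2}\}} ), where ‖G‖_∞ is the supremum norm of G. -/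
open MeasureTheory Set ENNReal

noncomputable def NF (d : ℕ) (α lam : ℝ)
    (G : EuclideanSpace ℝ (Fin d) → EuclideanSpace ℝ (Fin d) → ℝ) (t : ℝ) : ℝ≥0∞ :=
  ⨆ y : EuclideanSpace ℝ (Fin d), ∫⁻ s in Set.Ioc (0 : ℝ) t,
    ∫⁻ zw : EuclideanSpace ℝ (Fin d) × EuclideanSpace ℝ (Fin d),
      ENNReal.ofReal ((Gam d lam s (y - zw.1) + eta d α s (y - zw.1)) *
        (G zw.1 zw.2 + G zw.2 zw.1) / ‖zw.1 - zw.2‖ ^ ((d : ℝ) + α))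


namespace P14

noncomputable def gk (d : ℕ) (k t r : ℝ) : ℝ := t ^ (-(d : ℝ) / 2) * Real.exp (-k * r ^ 2 / t)
noncomputable def et (e t r : ℝ) : ℝ := t / (t ^ ((1 : ℝ) / 2) + r) ^ e
noncomputable def Q (d : ℕ) (e k t r : ℝ) : ℝ := gk d k t r + et e t r

lemma pow_exp (k ε : ℝ) (hε : 0 < ε) : ∃ M : ℝ, 0 < M ∧ ∀ X : ℝ, 1 ≤ X →
    Real.exp (-ε * X) ≤ M * (1 / X) ^ k := by
  obtain ⟨n, hn⟩ := exists_nat_ge k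
  refine ⟨n.factorial / ε ^ n, by positivity, fun X hX => ?_⟩
  have hX0 : 0 < X := by linarith
  have h1 : (ε * X) ^ n / n.factorial ≤ Real.exp (ε * X) :=
    Real.pow_div_factorial_le_exp _ (by positivity) n
  have h2 : (1 / X) ^ n ≤ (1 / X) ^ k := by
    rw [← Real.rpow_natCast]
    exact Real.rpow_le_rpow_of_exponent_ge (by positivity) (by rw [div_le_one hX0]; exact hX) hn
  have h3 : Real.exp (-ε * X) ≤ n.factorial / (ε * X) ^ n := by
    rw [neg_mul, Real.exp_neg, ← one_div_div]
    rw [one_div]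
    exact inv_anti₀ (by positivity) h1
  calc _ ≤ _ := h3
    _ = n.factorial / ε ^ n * (1 / X) ^ n := by rw [mul_pow, div_pow, one_pow]; field_simp
    _ ≤ _ := by gcongr

lemma gk_pos {d : ℕ} {k t r : ℝ} (ht : 0 < t) : 0 < gk d k t r := by
  unfold gk; positivity

lemma et_pos {e t r : ℝ} (ht : 0 < t) (hr : 0 ≤ r) : 0 < et e t r := by
  unfold et; positivity

lemma gk_mono {d : ℕ} {k k' t r : ℝ} (ht : 0 < t) (h : k ≤ k') : gk d k' t r ≤ gk d k t r := by
  unfold gk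
  gcongr

lemma et_le {e v β : ℝ} (he : 0 < e) (hv : 0 < v) (hβ : 0 < β) : et e v β ≤ v / β ^ e := by
  unfold et
  have : 0 < v ^ ((1:ℝ)/2) := by positivity
  gcongr
  linarith

lemma et_ge {e t r : ℝ} (he : 0 < e) (ht : 0 < t) (hr : 0 < r) (htr : t ≤ r ^ 2) :
    t / r ^ e ≤ 2 ^ e * et e t r := by
  unfold et
  have h1 : t ^ ((1:ℝ)/2) ≤ r := by
    rw [← Real.sqrt_eq_rpow]; exact (Real.sqrt_le_left hr.le).mpr htr
  have h2 : (t ^ ((1:ℝ)/2) + r) ^ e ≤ (2 * r) ^ e := by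
    gcongr; linarith
  rw [Real.mul_rpow (by norm_num) hr.le] at h2
  have : 0 < t ^ ((1:ℝ)/2) := by positivity
  rw [← mul_div_assoc, div_le_div_iff₀ (by positivity) (by positivity)]
  nlinarith

/-- E1 -/
lemma et_le_et {e t r v β : ℝ} (he : 0 < e) (hv : 0 < v) (hvt : v ≤ t) (hr : 0 < r)
    (htr : t ≤ r ^ 2) (hβ : r / 20 ≤ β) : et e v β ≤ 20 ^ e * 2 ^ e * et e t r := by
  have ht : 0 < t := by linarith
  have h1 := et_le he hv (show 0 < β by have : 0 < r / 20 := by positivity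
                                        linarith)
  have h2 : v / β ^ e ≤ t / (r / 20) ^ e := by gcongr
  have h3 : t / (r / 20) ^ e = 20 ^ e * (t / r ^ e) := by
    rw [Real.div_rpow hr.le (by norm_num)]; field_simp
  have := et_ge he ht hr htr
  calc _ ≤ 20 ^ e * (t / r ^ e) := by linarith
    _ ≤ 20 ^ e * (2 ^ e * et e t r) := by gcongr
    _ = _ := by ring

/-- Lemma A -/
lemma gk_le_gk (d : ℕ) (c : ℝ) (hc : 0 < c) : ∃ M : ℝ, 0 < M ∧ ∀ k t r v β : ℝ, 0 < v → v ≤ t →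
    0 < r → t ≤ r ^ 2 → 2 * c * r ^ 2 / t + 2 / 5 * c * r ^ 2 / v ≤ k * β ^ 2 / v →
    gk d k v β ≤ M * gk d (2 * c) t r := by
  obtain ⟨M, hM, h⟩ := pow_exp ((d:ℝ)/2) (2/5 * c) (by positivity)
  refine ⟨M, hM, fun k t r v β hv hvt hr htr hk => ?_⟩
  have ht : 0 < t := by linarith
  have h1 := h (r ^ 2 / v) (by rw [one_le_div hv]; linarith)
  rw [one_div_div] at h1
  have h2 : v ^ (-(d:ℝ)/2) * (v / r ^ 2) ^ ((d:ℝ)/2) ≤ t ^ (-(d:ℝ)/2) := by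
    rw [Real.div_rpow hv.le (by positivity), neg_div, Real.rpow_neg hv.le, Real.rpow_neg ht.le]
    have : v ^ ((d:ℝ)/2) > 0 := by positivity
    rw [← mul_div_assoc, inv_mul_cancel₀ this.ne', one_div]
    gcongr
  unfold gk
  have h3 : Real.exp (-k * β ^ 2 / v) ≤ Real.exp (-(2/5*c) * (r^2/v)) * Real.exp (-(2*c) * r^2/t) := by
    rw [← Real.exp_add]
    gcongr
    have e1 : -k * β ^ 2 / v = - (k * β ^ 2 / v) := by ring
    have e2 : -(2 / 5 * c) * (r ^ 2 / v) + -(2 * c) * r ^ 2 / t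
      = -(2 * c * r ^ 2 / t + 2 / 5 * c * r ^ 2 / v) := by ring
    rw [e1, e2]; linarith
  calc _ ≤ v ^ (-(d:ℝ)/2) * ((M * (v / r^2) ^ ((d:ℝ)/2)) * Real.exp (-(2*c) * r^2/t)) := by
        gcongr
        exact h3.trans (by gcongr)
    _ = M * ((v ^ (-(d:ℝ)/2) * (v / r^2) ^ ((d:ℝ)/2)) * Real.exp (-(2*c) * r^2/t)) := by ring
    _ ≤ _ := by gcongr

lemma sed {A b u s : ℝ} (hu : 0 < u) (hs : 0 < s) : (A + b) ^ 2 / (u + s) ≤ A ^ 2 / u + b ^ 2 / s := by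
  rw [div_add_div _ _ hu.ne' hs.ne', div_le_div_iff₀ (by positivity) (by positivity)]
  nlinarith [sq_nonneg (A * s - b * u), mul_pos hu hs]

lemma pre {d : ℕ} {s t : ℝ} (ht : 0 < t) (hst : t / 4 ≤ s) :
    s ^ (-(d:ℝ)/2) ≤ 4 ^ ((d:ℝ)/2) * t ^ (-(d:ℝ)/2) := by
  have h : s ^ (-(d:ℝ)/2) ≤ (t/4) ^ (-(d:ℝ)/2) :=
    Real.rpow_le_rpow_of_nonpos (by positivity) hst (by
      have : (0:ℝ) ≤ d := by positivity
      linarith)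
  rw [Real.div_rpow ht.le (by norm_num), neg_div, Real.rpow_neg (by norm_num : (0:ℝ) ≤ 4)] at h
  rw [neg_div]
  refine h.trans (le_of_eq ?_)
  field_simp

lemma GG (d : ℕ) (e c : ℝ) (he : 0 < e) (hc : 0 < c) : ∃ M : ℝ, 0 < M ∧ ∀ t s u r A b D : ℝ,
    0 < s → 0 < u → s + u = t → 0 < r → t ≤ r ^ 2 → 0 ≤ A → 0 ≤ b → 0 ≤ D → r ≤ A + D + b →
    D < r / 20 →
    gk d (3*c) u A * gk d (2*c) s b ≤ M * (Q d e (2*c) t r * (Q d e c u A + Q d e c s b)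
      + (D/r)^e * (Q d e c u A * Q d e c s b)) := by
  obtain ⟨M, hM, hexp⟩ := pow_exp e (2/5 * c) (by positivity)
  refine ⟨M + 4 ^ ((d:ℝ)/2) * Real.exp (4*c), by positivity, ?_⟩
  intro t s u r A b D hs hu hsut hr htr hA hb hD hrr hDr
  have ht : 0 < t := by linarith
  have g1 := gk_pos (d := d) (k := c) (r := A) hu
  have g2 := gk_pos (d := d) (k := c) (r := b) hs
  have g3 := gk_pos (d := d) (k := 2*c) (r := r) ht
  have e1 := et_pos (e := e) hu hA
  have e2 := et_pos (e := e) hs hb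
  have e3 := et_pos (e := e) ht hr.le
  have hW : 0 ≤ (D/r)^e := by positivity
  have hT : gk d (2*c) t r ≤ Q d e (2*c) t r := by unfold Q; linarith
  have hP : gk d c u A ≤ Q d e c u A := by unfold Q; linarith
  have hP' : gk d c s b ≤ Q d e c s b := by unfold Q; linarith
  have hT0 : 0 ≤ Q d e (2*c) t r := by linarith
  have hP0 : 0 ≤ Q d e c u A := by linarith
  have hP0' : 0 ≤ Q d e c s b := by linarith
  have hE : (0:ℝ) < 4 ^ ((d:ℝ)/2) * Real.exp (4*c) := by positivity
  by_cases hDt : t / r ≤ D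
  · have k1 : gk d (3*c) u A * gk d (2*c) s b ≤ M * ((D/r)^e * (gk d c u A * gk d c s b)) := by
      have h1 : gk d (3*c) u A * gk d (2*c) s b = gk d c u A * gk d c s b *
          Real.exp (-(2*c) * (A^2/u) + -c * (b^2/s)) := by
        unfold gk
        have : Real.exp (-(3*c)*A^2/u) * Real.exp (-(2*c) * b^2/s) = Real.exp (-c*A^2/u) *
          Real.exp (-c * b^2/s) * Real.exp (-(2*c) * (A^2/u) + -c * (b^2/s)) := by
          rw [← Real.exp_add, ← Real.exp_add, ← Real.exp_add]; congr 1; ring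
        linear_combination (u ^ (-(d:ℝ)/2) * s ^ (-(d:ℝ)/2)) * this
      have h2 := sed (A := A) (b := b) hu hs
      have h3 : 2/5 * (r^2/t) ≤ (A+b)^2/(u+s) := by
        rw [add_comm u s, hsut, ← mul_div_assoc]
        gcongr
        have : 19/20 * r ≤ A + b := by linarith
        nlinarith
      have h4 : Real.exp (-(2*c) * (A^2/u) + -c * (b^2/s)) ≤ M * (D/r)^e := by
        calc _ ≤ Real.exp (-(2/5*c) * (r^2/t)) := by
              gcongr
              have : 0 ≤ A^2/u := by positivity
              nlinarith
          _ ≤ M * (1/(r^2/t))^e := hexp _ (by rw [one_le_div ht]; exact htr)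
          _ ≤ _ := by
            refine mul_le_mul_of_nonneg_left (Real.rpow_le_rpow (by positivity) ?_ he.le) hM.le
            rw [one_div_div, div_le_div_iff₀ (by positivity) hr]
            rw [div_le_iff₀ hr] at hDt
            nlinarith
      rw [h1]
      calc _ ≤ gk d c u A * gk d c s b * (M * (D/r)^e) := by gcongr
        _ = _ := by ring
    refine k1.trans ?_
    have k2 : (D/r)^e * (gk d c u A * gk d c s b) ≤ (Q d e (2*c) t r * (Q d e c u A + Q d e c s b)
      + (D/r)^e * (Q d e c u A * Q d e c s b)) := by
      have : (D/r)^e * (gk d c u A * gk d c s b) ≤ (D/r)^e * (Q d e c u A * Q d e c s b) := by gcongr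
      have : 0 ≤ Q d e (2*c) t r * (Q d e c u A + Q d e c s b) :=
        mul_nonneg (by linarith) (by linarith)
      linarith
    gcongr
    linarith
  · push Not at hDt
    have hsq : r^2/t - 2 ≤ (A+b)^2/t := by
      rw [div_sub' ht.ne']
      gcongr
      have h1 : r - t / r ≤ A + b := by linarith
      have h2 : 0 ≤ r - t/r := by
        have : t / r ≤ r := by rw [div_le_iff₀ hr]; nlinarith
        linarith
      have h3 : (r - t/r)^2 ≤ (A+b)^2 := by gcongr
      have h4 : (r - t/r)^2 = r^2 - 2*t + (t/r)^2 := by field_simp; ring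
      nlinarith [sq_nonneg (t/r)]
    have hfin : gk d (3*c) u A * gk d (2*c) s b ≤ (4 ^ ((d:ℝ)/2) * Real.exp (4*c)) *
        (gk d (2*c) t r * (gk d c u A + gk d c s b)) := by
      by_cases hst : t/4 ≤ s
      · have h1 : Real.exp (-(3*c)*A^2/u) * Real.exp (-(2*c) * b^2/s) ≤
            Real.exp (-c*A^2/u) * (Real.exp (4*c) * Real.exp (-(2*c)*r^2/t)) := by
          rw [← Real.exp_add, ← Real.exp_add, ← Real.exp_add]
          apply Real.exp_le_exp.mpr
          have h2 := sed (A := A) (b := b) hu hs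
          rw [add_comm u s, hsut] at h2
          have h3 : r^2/t - 2 ≤ A^2/u + b^2/s := by linarith
          have := mul_le_mul_of_nonneg_left h3 hc.le
          have e1 : -(3*c)*A^2/u + -(2*c) * b^2/s = -c*A^2/u - 2 * (c * (A^2/u+b^2/s)) := by ring
          rw [e1]
          have e2 : -(2*c)*r^2/t = -2 * (c * (r^2/t)) := by ring
          rw [e2]; linarith
        have h5 := pre (d := d) ht hst
        calc gk d (3*c) u A * gk d (2*c) s b = u ^ (-(d:ℝ)/2) * s ^ (-(d:ℝ)/2) *
              (Real.exp (-(3*c)*A^2/u) * Real.exp (-(2*c) * b^2/s)) := by unfold gk; ring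
          _ ≤ u ^ (-(d:ℝ)/2) * (4 ^ ((d:ℝ)/2) * t ^ (-(d:ℝ)/2)) *
              (Real.exp (-c*A^2/u) * (Real.exp (4*c) * Real.exp (-(2*c)*r^2/t))) := by gcongr
          _ = (4 ^ ((d:ℝ)/2) * Real.exp (4*c)) * (gk d (2*c) t r * (gk d c u A + 0)) := by
              unfold gk; ring
          _ ≤ _ := by gcongr
      · push Not at hst
        have h1 : Real.exp (-(3*c)*A^2/u) * Real.exp (-(2*c) * b^2/s) ≤
            Real.exp (-c*b^2/s) * (Real.exp (4*c) * Real.exp (-(2*c)*r^2/t)) := by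
          rw [← Real.exp_add, ← Real.exp_add, ← Real.exp_add]
          apply Real.exp_le_exp.mpr
          have h2 := sed (A := A) (b := b) (show 0 < u/3 by positivity) hs
          have h2' : (A+b)^2/(t/2) ≤ (A+b)^2/(u/3+s) := by
            gcongr
            linarith
          have e0 : (A+b)^2/(t/2) = 2 * ((A+b)^2/t) := by field_simp
          have e0' : A^2/(u/3) = 3 * (A^2/u) := by field_simp
          rw [e0'] at h2
          have h3 : 2 * (r^2/t) - 4 ≤ 3 * (A^2/u) + b^2/s := by linarith
          have := mul_le_mul_of_nonneg_left h3 hc.le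
          have e1 : -(3*c)*A^2/u + -(2*c) * b^2/s = -c*b^2/s - (c * (3 * (A^2/u)+b^2/s)) := by ring
          rw [e1]
          have e2 : -(2*c)*r^2/t = -2 * (c * (r^2/t)) := by ring
          rw [e2]; linarith
        have h5 := pre (d := d) (s := u) ht (by linarith)
        calc gk d (3*c) u A * gk d (2*c) s b = u ^ (-(d:ℝ)/2) * s ^ (-(d:ℝ)/2) *
              (Real.exp (-(3*c)*A^2/u) * Real.exp (-(2*c) * b^2/s)) := by unfold gk; ring
          _ ≤ (4 ^ ((d:ℝ)/2) * t ^ (-(d:ℝ)/2)) * s ^ (-(d:ℝ)/2) *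
              (Real.exp (-c*b^2/s) * (Real.exp (4*c) * Real.exp (-(2*c)*r^2/t))) := by gcongr
          _ = (4 ^ ((d:ℝ)/2) * Real.exp (4*c)) * (gk d (2*c) t r * (0 + gk d c s b)) := by
              unfold gk; ring
          _ ≤ _ := by gcongr
    refine hfin.trans ?_
    have k2 : gk d (2*c) t r * (gk d c u A + gk d c s b) ≤ (Q d e (2*c) t r * (Q d e c u A + Q d e c s b)
      + (D/r)^e * (Q d e c u A * Q d e c s b)) := by
      have : gk d (2*c) t r * (gk d c u A + gk d c s b) ≤ Q d e (2*c) t r * (Q d e c u A + Q d e c s b) := by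
        gcongr
      have : 0 ≤ (D/r)^e * (Q d e c u A * Q d e c s b) :=
        mul_nonneg hW (mul_nonneg (by linarith) (by linarith))
      linarith
    gcongr
    linarith

lemma comb1 {T P P' W X Y M N : ℝ} (hT : 0 ≤ T) (hP : 0 ≤ P) (hP' : 0 ≤ P')
    (hW : 0 ≤ W) (hX : 0 ≤ X) (hM : 0 ≤ M) (hMN : M ≤ N) (hXP : X ≤ P) (hY : Y ≤ M * T) :
    X * Y ≤ N * (T * (P + P') + W * (P * P')) := by
  have h1 : X * Y ≤ X * (M * T) := by gcongr
  have h2 : X * (M * T) ≤ P * (N * T) := by gcongr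
  have h3 : 0 ≤ N * (T * P' + W * (P * P')) := by
    have := hM.trans hMN
    positivity
  nlinarith

lemma comb2 {T P P' W X Y M N : ℝ} (hT : 0 ≤ T) (hP : 0 ≤ P) (hP' : 0 ≤ P')
    (hW : 0 ≤ W) (hY : 0 ≤ Y) (hM : 0 ≤ M) (hMN : M ≤ N) (hYP : Y ≤ P') (hX : X ≤ M * T) :
    X * Y ≤ N * (T * (P + P') + W * (P * P')) := by
  have h1 := comb1 hT hP' hP hW hY hM hMN hYP hX
  linarith [mul_comm X Y, mul_comm P P', add_comm P P']

lemma hpw_aux {e t r β : ℝ} (he : 0 < e) (ht : 0 < t) (hr : 0 < r) (hβ : t/r ≤ β) :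
    (t/r^2)^e ≤ (β/r)^e := by
  refine Real.rpow_le_rpow (by positivity) ?_ he.le
  rw [div_le_div_iff₀ (by positivity) hr]
  rw [div_le_iff₀ hr] at hβ
  nlinarith

lemma hb3_aux {t r b : ℝ} (ht : 0 < t) (hr : 0 < r) (hb : 0 ≤ b) (h1 : r - 2*(t/r) ≤ b) :
    r^2 - 4*t ≤ b^2 := by
  have h2 : (t/r) * r = t := by field_simp
  by_cases h : r ≤ b
  · nlinarith
  · nlinarith [sq_nonneg (b-r)]

set_option maxHeartbeats 1000000 in
lemma EG (d : ℕ) (e c : ℝ) (he : 0 < e) (hc : 0 < c) : ∃ M : ℝ, 0 < M ∧ ∀ t s u r A b D : ℝ,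
    0 < s → 0 < u → s + u = t → 0 < r → t ≤ r ^ 2 → 0 ≤ A → 0 ≤ b → 0 ≤ D → r ≤ A + D + b →
    D < r / 20 →
    et e u A * gk d (2*c) s b ≤ M * (Q d e (2*c) t r * (Q d e c u A + Q d e c s b)
      + (D/r)^e * (Q d e c u A * Q d e c s b)) := by
  obtain ⟨M, hM, hexp⟩ := pow_exp e (4/5 * c) (by positivity)
  obtain ⟨M1, hM1, hA1⟩ := gk_le_gk d c hc
  obtain ⟨N, hN⟩ : ∃ N : ℝ, N = M + M1 + 20 ^ e * 2 ^ e + M * 2 ^ e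
      + 4 ^ ((d:ℝ)/2) * Real.exp (16*c) := ⟨_, rfl⟩
  have q1 : 0 < (20:ℝ) ^ e * 2 ^ e := by positivity
  have q2 : 0 < M * (2:ℝ) ^ e := by positivity
  have q3 : 0 < 4 ^ ((d:ℝ)/2) * Real.exp (16*c) := by positivity
  have hN0 : 0 < N := by linarith
  refine ⟨N, hN0, ?_⟩
  intro t s u r A b D hs hu hsut hr htr hA hb hD hrr hDr
  have ht : 0 < t := by linarith
  have g1 := gk_pos (d := d) (k := c) (r := A) hu
  have g2 := gk_pos (d := d) (k := c) (r := b) hs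
  have g2' := gk_pos (d := d) (k := 2*c) (r := b) hs
  have g3 := gk_pos (d := d) (k := 2*c) (r := r) ht
  have gm : gk d (2*c) s b ≤ gk d c s b := gk_mono hs (by linarith)
  have e1 := et_pos (e := e) hu hA
  have e2 := et_pos (e := e) hs hb
  have e3 := et_pos (e := e) ht hr.le
  have hW : 0 ≤ (D/r)^e := by positivity
  have hT : gk d (2*c) t r ≤ Q d e (2*c) t r := by unfold Q; linarith
  have hTe : et e t r ≤ Q d e (2*c) t r := by unfold Q; linarith
  have hP : et e u A ≤ Q d e c u A := by unfold Q; linarith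
  have hP' : gk d c s b ≤ Q d e c s b := by unfold Q; linarith
  have hT0 : 0 ≤ Q d e (2*c) t r := by linarith
  have hP0 : 0 ≤ Q d e c u A := by linarith
  have hP0' : 0 ≤ Q d e c s b := by linarith
  by_cases hAr : r / 20 ≤ A
  · refine comb2 hT0 hP0 hP0' hW g2'.le q1.le (by linarith) (by linarith)
      ((et_le_et he hu (by linarith) hr htr hAr).trans ?_)
    gcongr
  push Not at hAr
  have hbr : 9/10 * r ≤ b := by linarith
  have hb2 : 81/100 * r^2 ≤ b^2 := by nlinarith
  by_cases hst : s < t/2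
  · refine comb1 hT0 hP0 hP0' hW e1.le hM1.le (by linarith) hP
      ((hA1 (2*c) t r s b hs (by linarith) hr htr ?_).trans (by gcongr))
    have h1 : 2*c*r^2/t ≤ 2*c*r^2/(2*s) := by gcongr; linarith
    have h2 : 2*c*r^2/(2*s) = c*r^2/s := by field_simp
    have h3 : c*r^2/s + 2/5*c*r^2/s = (7/5*c*r^2)/s := by ring
    have h4 : (7/5*c*r^2)/s ≤ 2*c*b^2/s := by gcongr ?_ / s; nlinarith
    linarith
  push Not at hst
  have hgs : gk d (2*c) s b ≤ gk d c s b * (M * (t/r^2)^e) := by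
    have h1 : gk d (2*c) s b = gk d c s b * Real.exp (-c * (b^2/s)) := by
      unfold gk
      rw [mul_assoc, ← Real.exp_add]; congr 2; ring
    have h2 : Real.exp (-c * (b^2/s)) ≤ M * (t/r^2)^e := by
      rw [← one_div_div (r^2) t]
      refine le_trans (Real.exp_le_exp.mpr ?_) (hexp _ (by rw [one_le_div ht]; exact htr))
      have : 4/5 * (r^2/t) ≤ b^2/s := by
        rw [← mul_div_assoc]
        gcongr
        · nlinarith
        · linarith
      nlinarith
    rw [h1]; gcongr
  have hpw : ∀ β, t/r ≤ β → (t/r^2)^e ≤ (β/r)^e := by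
    exact fun β hβ => hpw_aux he ht hr hβ
  by_cases hDt : t/r ≤ D
  · have h1 : gk d (2*c) s b ≤ gk d c s b * (M * (D/r)^e) := by
      refine hgs.trans ?_
      gcongr _ * (M * ?_)
      exact hpw D hDt
    calc _ ≤ Q d e c u A * (Q d e c s b * (M * (D/r)^e)) := by
          refine mul_le_mul hP (h1.trans ?_) g2'.le hP0
          gcongr
      _ = M * (0 + (D/r)^e * (Q d e c u A * Q d e c s b)) := by ring
      _ ≤ N * (Q d e (2*c) t r * (Q d e c u A + Q d e c s b) + (D/r)^e * (Q d e c u A * Q d e c s b)) := by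
          gcongr
          · linarith
          · positivity
  push Not at hDt
  by_cases hAt : t/r ≤ A
  · have hA0 : 0 < A := lt_of_lt_of_le (by positivity) hAt
    have h1 : et e u A * gk d (2*c) s b ≤ (M * 2^e * et e t r) * gk d c s b := by
      have h2 : (t/r^2)^e * et e u A ≤ 2^e * et e t r := by
        calc _ ≤ (A/r)^e * (t/A^e) := by
              gcongr ?_ * ?_
              · exact hpw A hAt
              · exact (et_le he hu hA0).trans (by gcongr; linarith)
          _ = t/r^e := by
              rw [Real.div_rpow hA hr.le]
              have : A^e ≠ 0 := by positivity
              field_simp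
          _ ≤ _ := et_ge he ht hr htr
      calc _ ≤ et e u A * (gk d c s b * (M * (t/r^2)^e)) := by gcongr
        _ = M * ((t/r^2)^e * et e u A) * gk d c s b := by ring
        _ ≤ M * (2^e * et e t r) * gk d c s b := by gcongr
        _ = _ := by ring
    refine h1.trans (comb2 hT0 hP0 hP0' hW g2.le q2.le (by linarith) hP' (by gcongr))
  push Not at hAt
  have hb3 : r^2 - 4*t ≤ b^2 := by
    exact hb3_aux ht hr hb (by linarith)
  refine comb1 hT0 hP0 hP0' hW e1.le q3.le (by linarith) hP ?_
  refine le_trans ?_ (mul_le_mul_of_nonneg_left hT q3.le)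
  have h5 := pre (d := d) (s := s) ht (by linarith)
  unfold gk
  have h6 : Real.exp (-(2*c)*b^2/s) ≤ Real.exp (16*c) * Real.exp (-(2*c)*r^2/t) := by
    rw [← Real.exp_add]
    apply Real.exp_le_exp.mpr
    have h7 : r^2/t - 8 ≤ b^2/s := by
      have a1 : r^2/t ≤ r^2/s := by gcongr; linarith
      have a2 : (r^2 - 4*t)/s ≤ b^2/s := by gcongr
      have a3 : t/s ≤ 2 := by rw [div_le_iff₀ hs]; linarith
      have a4 : (r^2 - 4*t)/s = r^2/s - 4*(t/s) := by ring
      linarith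
    have e1 : -(2*c)*b^2/s = -2 * (c*(b^2/s)) := by ring
    have e2 : -(2*c)*r^2/t = -2 * (c*(r^2/t)) := by ring
    rw [e1, e2]; nlinarith
  calc _ ≤ (4 ^ ((d:ℝ)/2) * t ^ (-(d:ℝ)/2)) * (Real.exp (16*c) * Real.exp (-(2*c)*r^2/t)) := by
        gcongr
    _ = _ := by ring

lemma GE (d : ℕ) (e c : ℝ) (he : 0 < e) (hc : 0 < c) : ∃ M : ℝ, 0 < M ∧ ∀ t s u r A b D : ℝ,
    0 < s → 0 < u → s + u = t → 0 < r → t ≤ r ^ 2 → 0 ≤ A → 0 ≤ b → 0 ≤ D → r ≤ A + D + b →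
    D < r / 20 →
    gk d (3*c) u A * et e s b ≤ M * (Q d e (2*c) t r * (Q d e c u A + Q d e c s b)
      + (D/r)^e * (Q d e c u A * Q d e c s b)) := by
  obtain ⟨M1, hM1, hA1⟩ := gk_le_gk d c hc
  have q1 : 0 < (20:ℝ) ^ e * 2 ^ e := by positivity
  refine ⟨M1 + 20 ^ e * 2 ^ e, by positivity, ?_⟩
  intro t s u r A b D hs hu hsut hr htr hA hb hD hrr hDr
  have ht : 0 < t := by linarith
  have g1 := gk_pos (d := d) (k := c) (r := A) hu
  have g1' := gk_pos (d := d) (k := 3*c) (r := A) hu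
  have g2 := gk_pos (d := d) (k := c) (r := b) hs
  have g3 := gk_pos (d := d) (k := 2*c) (r := r) ht
  have gm : gk d (3*c) u A ≤ gk d c u A := gk_mono hu (by linarith)
  have e1 := et_pos (e := e) hu hA
  have e2 := et_pos (e := e) hs hb
  have e3 := et_pos (e := e) ht hr.le
  have hW : 0 ≤ (D/r)^e := by positivity
  have hT : gk d (2*c) t r ≤ Q d e (2*c) t r := by unfold Q; linarith
  have hTe : et e t r ≤ Q d e (2*c) t r := by unfold Q; linarith
  have hP : gk d c u A ≤ Q d e c u A := by unfold Q; linarith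
  have hP' : et e s b ≤ Q d e c s b := by unfold Q; linarith
  have hT0 : 0 ≤ Q d e (2*c) t r := by linarith
  have hP0 : 0 ≤ Q d e c u A := by linarith
  have hP0' : 0 ≤ Q d e c s b := by linarith
  by_cases hbr : r / 20 ≤ b
  · refine comb1 hT0 hP0 hP0' hW g1'.le q1.le (by linarith) (by linarith)
      ((et_le_et he hs (by linarith) hr htr hbr).trans ?_)
    gcongr
  push Not at hbr
  have hAr : 9/10 * r ≤ A := by linarith
  have hA2 : 81/100 * r^2 ≤ A^2 := by nlinarith
  refine comb2 hT0 hP0 hP0' hW e2.le hM1.le (by linarith) hP'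
      ((hA1 (3*c) t r u A hu (by linarith) hr htr ?_).trans (by gcongr))
  have h1 : 2*c*r^2/t ≤ 2*c*r^2/u := by gcongr; linarith
  have h3 : 2*c*r^2/u + 2/5*c*r^2/u = (12/5*c*r^2)/u := by ring
  have h4 : (12/5*c*r^2)/u ≤ 3*c*A^2/u := by gcongr ?_ / u; nlinarith
  linarith

lemma EE (d : ℕ) (e c : ℝ) (he : 0 < e) : ∃ M : ℝ, 0 < M ∧ ∀ t s u r A b D : ℝ,
    0 < s → 0 < u → s + u = t → 0 < r → t ≤ r ^ 2 → 0 ≤ A → 0 ≤ b → 0 ≤ D → r ≤ A + D + b →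
    D < r / 20 →
    et e u A * et e s b ≤ M * (Q d e (2*c) t r * (Q d e c u A + Q d e c s b)
      + (D/r)^e * (Q d e c u A * Q d e c s b)) := by
  have q1 : 0 < (20:ℝ) ^ e * 2 ^ e := by positivity
  refine ⟨20 ^ e * 2 ^ e, by positivity, ?_⟩
  intro t s u r A b D hs hu hsut hr htr hA hb hD hrr hDr
  have ht : 0 < t := by linarith
  have g1 := gk_pos (d := d) (k := c) (r := A) hu
  have g2 := gk_pos (d := d) (k := c) (r := b) hs
  have g3 := gk_pos (d := d) (k := 2*c) (r := r) ht
  have e1 := et_pos (e := e) hu hA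
  have e2 := et_pos (e := e) hs hb
  have e3 := et_pos (e := e) ht hr.le
  have hW : 0 ≤ (D/r)^e := by positivity
  have hTe : et e t r ≤ Q d e (2*c) t r := by unfold Q; linarith
  have hP : et e u A ≤ Q d e c u A := by unfold Q; linarith
  have hP' : et e s b ≤ Q d e c s b := by unfold Q; linarith
  have hT0 : 0 ≤ Q d e (2*c) t r := by linarith
  have hP0 : 0 ≤ Q d e c u A := by linarith
  have hP0' : 0 ≤ Q d e c s b := by linarith
  by_cases hbr : r / 20 ≤ b
  · refine comb1 hT0 hP0 hP0' hW e1.le q1.le le_rfl (by linarith)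
      ((et_le_et he hs (by linarith) hr htr hbr).trans ?_)
    gcongr
  push Not at hbr
  refine comb2 hT0 hP0 hP0' hW e2.le q1.le le_rfl (by linarith)
      ((et_le_et he hu (by linarith) hr htr (by linarith)).trans ?_)
  gcongr

lemma big (d : ℕ) (e c : ℝ) (he : 0 < e) (hc : 0 < c) : ∃ M : ℝ, 0 < M ∧ ∀ t s u r A b D : ℝ,
    0 < s → 0 < u → s + u = t → 0 < r → t ≤ r ^ 2 → 0 ≤ A → 0 ≤ b → 0 ≤ D → r ≤ A + D + b →
    Q d e (3*c) u A * Q d e (2*c) s b ≤ M * (Q d e (2*c) t r * (Q d e c u A + Q d e c s b)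
      + (D/r)^e * (Q d e c u A * Q d e c s b)) := by
  obtain ⟨M1, hM1, h1⟩ := GG d e c he hc
  obtain ⟨M2, hM2, h2⟩ := GE d e c he hc
  obtain ⟨M3, hM3, h3⟩ := EG d e c he hc
  obtain ⟨M4, hM4, h4⟩ := EE d e c he
  refine ⟨M1 + M2 + M3 + M4 + 20 ^ e, by positivity, ?_⟩
  intro t s u r A b D hs hu hsut hr htr hA hb hD hrr
  have ht : 0 < t := by linarith
  have g1 := gk_pos (d := d) (k := c) (r := A) hu
  have g2 := gk_pos (d := d) (k := c) (r := b) hs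
  have g3 := gk_pos (d := d) (k := 2*c) (r := r) ht
  have g1' := gk_pos (d := d) (k := 3*c) (r := A) hu
  have g2' := gk_pos (d := d) (k := 2*c) (r := b) hs
  have e1 := et_pos (e := e) hu hA
  have e2 := et_pos (e := e) hs hb
  have e3 := et_pos (e := e) ht hr.le
  have hW : 0 ≤ (D/r)^e := by positivity
  have gm1 : gk d (3*c) u A ≤ gk d c u A := gk_mono hu (by linarith)
  have gm2 : gk d (2*c) s b ≤ gk d c s b := gk_mono hs (by linarith)
  have hT0 : 0 ≤ Q d e (2*c) t r := by unfold Q; linarith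
  have hP0 : 0 ≤ Q d e c u A := by unfold Q; linarith
  have hP0' : 0 ≤ Q d e c s b := by unfold Q; linarith
  have hZ : 0 ≤ (Q d e (2*c) t r * (Q d e c u A + Q d e c s b)
      + (D/r)^e * (Q d e c u A * Q d e c s b)) := by positivity
  have h20 : (0:ℝ) < 20 ^ e := by positivity
  by_cases hDr : D < r/20
  · have := h1 t s u r A b D hs hu hsut hr htr hA hb hD hrr hDr
    have := h2 t s u r A b D hs hu hsut hr htr hA hb hD hrr hDr
    have := h3 t s u r A b D hs hu hsut hr htr hA hb hD hrr hDr
    have := h4 t s u r A b D hs hu hsut hr htr hA hb hD hrr hDr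
    have k : Q d e (3*c) u A * Q d e (2*c) s b = gk d (3*c) u A * gk d (2*c) s b
      + gk d (3*c) u A * et e s b + et e u A * gk d (2*c) s b + et e u A * et e s b := by
      unfold Q; ring
    rw [k]
    have := mul_nonneg h20.le hZ
    linarith
  · push Not at hDr
    have hQ1 : Q d e (3*c) u A ≤ Q d e c u A := by unfold Q; linarith
    have hQ2 : Q d e (2*c) s b ≤ Q d e c s b := by unfold Q; linarith
    have hQ3 : 0 ≤ Q d e (2*c) s b := by unfold Q; linarith
    have hw : 1 ≤ 20^e * (D/r)^e := by
      rw [← Real.mul_rpow (by norm_num) (by positivity)]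
      apply Real.one_le_rpow _ he.le
      rw [← mul_div_assoc, one_le_div hr]; linarith
    have k : Q d e (3*c) u A * Q d e (2*c) s b ≤ Q d e c u A * Q d e c s b :=
      mul_le_mul hQ1 hQ2 hQ3 hP0
    calc _ ≤ 1 * (Q d e c u A * Q d e c s b) := by linarith
      _ ≤ (20^e * (D/r)^e) * (Q d e c u A * Q d e c s b) := by gcongr
      _ = 20^e * (0 + (D/r)^e * (Q d e c u A * Q d e c s b)) := by ring
      _ ≤ _ := by
        gcongr
        · linarith
        · positivity

lemma Q_le {d : ℕ} {e k v β : ℝ} (he : 0 < e) (he2 : e ≤ d + 2) (hk : 0 ≤ k) (hv : 0 < v) (hv1 : v ≤ 1)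
    (hβ : 0 ≤ β) : Q d e k v β ≤ 2 * v ^ (-(d:ℝ)/2) := by
  have h1 : gk d k v β ≤ v ^ (-(d:ℝ)/2) := by
    unfold gk
    apply mul_le_of_le_one_right (by positivity)
    rw [Real.exp_le_one_iff]
    have : 0 ≤ k * β^2/v := by positivity
    have h : -k * β^2/v = -(k * β^2/v) := by ring
    linarith
  have h2 : et e v β ≤ v ^ (-(d:ℝ)/2) := by
    unfold et
    calc _ ≤ v / (v ^ ((1:ℝ)/2)) ^ e := by gcongr; linarith
      _ = v ^ (1 - e/2) := by
        rw [← Real.rpow_mul hv.le, Real.rpow_sub hv, Real.rpow_one]; congr 2; ring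
      _ ≤ _ := Real.rpow_le_rpow_of_exponent_ge hv hv1 (by linarith)
  unfold Q; linarith

theorem key (d : ℕ) (e c : ℝ) (he : 0 < e) (he2 : e ≤ d + 2) (hc : 0 < c) :
    ∃ M : ℝ, 0 < M ∧ ∀ t s u r A b D : ℝ,
    0 < s → 0 < u → s + u = t → t ≤ 1 → 0 ≤ r → 0 ≤ A → 0 ≤ b → 0 ≤ D → r ≤ A + D + b →
    Q d e (3*c) u A * Q d e (2*c) s b ≤ M * (Q d e (2*c) t r * (Q d e c u A + Q d e c s b)
      + (if t ^ ((1:ℝ)/2) < r then Q d e (2*c) t r / t * D^e * (Q d e c u A * Q d e c s b) else 0)) := by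
  obtain ⟨M, hM, h⟩ := big d e c he hc
  refine ⟨M * (1 + 2^e) + 2 * 4 ^ ((d:ℝ)/2) * Real.exp (2*c), by positivity, ?_⟩
  intro t s u r A b D hs hu hsut ht1 hr hA hb hD hrr
  have ht : 0 < t := by linarith
  have g1 := gk_pos (d := d) (k := c) (r := A) hu
  have g2 := gk_pos (d := d) (k := c) (r := b) hs
  have g3 := gk_pos (d := d) (k := 2*c) (r := r) ht
  have g1' := gk_pos (d := d) (k := 3*c) (r := A) hu
  have g2' := gk_pos (d := d) (k := 2*c) (r := b) hs
  have e1 := et_pos (e := e) hu hA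
  have e2 := et_pos (e := e) hs hb
  have e3 := et_pos (e := e) ht hr
  have gm1 : gk d (3*c) u A ≤ gk d c u A := gk_mono hu (by linarith)
  have gm2 : gk d (2*c) s b ≤ gk d c s b := gk_mono hs (by linarith)
  have hT0 : 0 ≤ Q d e (2*c) t r := by unfold Q; linarith
  have hP0 : 0 ≤ Q d e c u A := by unfold Q; linarith
  have hP0' : 0 ≤ Q d e c s b := by unfold Q; linarith
  have hQ1 : Q d e (3*c) u A ≤ Q d e c u A := by unfold Q; linarith
  have hQ2 : Q d e (2*c) s b ≤ Q d e c s b := by unfold Q; linarith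
  have hQ3 : 0 ≤ Q d e (2*c) s b := by unfold Q; linarith
  have hQ4 : 0 ≤ Q d e (3*c) u A := by unfold Q; linarith
  split_ifs with hif
  · have hr0 : 0 < r := lt_of_le_of_lt (by positivity) hif
    have htr : t ≤ r^2 := by
      rw [← Real.sqrt_eq_rpow] at hif
      exact ((Real.sqrt_lt' hr0).mp hif).le
    refine (h t s u r A b D hs hu hsut hr0 htr hA hb hD hrr).trans ?_
    have hw : (D/r)^e ≤ 2^e * (Q d e (2*c) t r / t * D^e) := by
      have := et_ge he ht hr0 htr
      have h4 : t / r^e ≤ 2^e * Q d e (2*c) t r := by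
        refine this.trans ?_
        gcongr
        unfold Q; linarith
      rw [Real.div_rpow hD hr0.le]
      calc D^e/r^e = (t/r^e) * (D^e/t) := by field_simp
        _ ≤ (2^e * Q d e (2*c) t r) * (D^e/t) := by gcongr
        _ = _ := by ring
    have h2 : (0:ℝ) < 2^e := by positivity
    have hX : 0 ≤ Q d e (2*c) t r * (Q d e c u A + Q d e c s b) := by positivity
    have hY : 0 ≤ Q d e (2*c) t r / t * D^e * (Q d e c u A * Q d e c s b) := by positivity
    calc _ ≤ M * (Q d e (2*c) t r * (Q d e c u A + Q d e c s b) +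
          (2^e * (Q d e (2*c) t r / t * D^e)) * (Q d e c u A * Q d e c s b)) := by gcongr
      _ ≤ (M * (1 + 2^e)) * (Q d e (2*c) t r * (Q d e c u A + Q d e c s b) +
          Q d e (2*c) t r / t * D^e * (Q d e c u A * Q d e c s b)) := by
          have a1 := mul_nonneg (mul_nonneg hM.le h2.le) hX
          have a2 := mul_nonneg hM.le hY
          nlinarith
      _ ≤ _ := by
          gcongr
          have : 0 < 2 * 4 ^ ((d:ℝ)/2) * Real.exp (2*c) := by positivity
          linarith
  · push Not at hif
    have htr : r^2 ≤ t := by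
      rw [← Real.sqrt_eq_rpow] at hif
      exact (Real.le_sqrt hr ht.le).mp hif
    have hTl : t ^ (-(d:ℝ)/2) ≤ Real.exp (2*c) * Q d e (2*c) t r := by
      have : t ^ (-(d:ℝ)/2) ≤ Real.exp (2*c) * gk d (2*c) t r := by
        unfold gk
        rw [mul_left_comm, ← Real.exp_add]
        apply le_mul_of_one_le_right (by positivity)
        rw [Real.one_le_exp_iff]
        have h5 : r^2/t ≤ 1 := by rw [div_le_one ht]; exact htr
        have h6 : -(2*c)*r^2/t = -(2*c)*(r^2/t) := by ring
        rw [h6]; nlinarith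
      refine this.trans ?_
      gcongr
      unfold Q; linarith
    have hgen : ∀ k v β, 0 ≤ k → 0 ≤ β → t/4 ≤ v → v ≤ 1 → Q d e k v β ≤
        (2 * 4 ^ ((d:ℝ)/2) * Real.exp (2*c)) * Q d e (2*c) t r := by
      intro k v β hk hβ hv hv1
      have a := Q_le (k := k) (β := β) he he2 hk (by linarith : 0 < v) hv1 hβ
      have b := pre (d := d) ht hv
      have : (0:ℝ) < 4 ^ ((d:ℝ)/2) := by positivity
      calc _ ≤ 2 * (4 ^ ((d:ℝ)/2) * t ^ (-(d:ℝ)/2)) := by linarith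
        _ ≤ 2 * (4 ^ ((d:ℝ)/2) * (Real.exp (2*c) * Q d e (2*c) t r)) := by gcongr
        _ = _ := by ring
    have hq : 0 < 2 * 4 ^ ((d:ℝ)/2) * Real.exp (2*c) := by positivity
    have hle : 2 * 4 ^ ((d:ℝ)/2) * Real.exp (2*c) ≤
      M * (1 + 2^e) + 2 * 4 ^ ((d:ℝ)/2) * Real.exp (2*c) := by
      have : 0 < M * (1 + (2:ℝ)^e) := by positivity
      linarith
    by_cases hst : t/4 ≤ s
    · have := comb1 (W := 0) hT0 hP0 hP0' le_rfl hQ4 hq.le hle hQ1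
        (hgen (2*c) s b (by positivity) hb hst (by linarith))
      simpa using this
    · have := comb2 (W := 0) hT0 hP0 hP0' le_rfl hQ3 hq.le hle hQ2
        (hgen (3*c) u A (by positivity) hA (by linarith) (by linarith))
      simpa using this

lemma Q_bound (d : ℕ) (e c : ℝ) (he : 0 < e) (he2 : e ≤ d + 2) (hc : 0 < c) :
    ∃ M : ℝ, 0 < M ∧ ∀ s β : ℝ, 0 < s → s ≤ 1 → 0 ≤ β →
      Q d e c s β ≤ M * s ^ (-(d:ℝ)/2) * (1 + (√s)⁻¹ * β) ^ (-e) := by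
  obtain ⟨M, hM, h⟩ := pow_exp (e/2) (c/2) (by positivity)
  refine ⟨M * Real.exp c + 1, by positivity, ?_⟩
  intro s β hs hs1 hβ
  have hq : 0 < √s := Real.sqrt_pos.mpr hs
  obtain ⟨X, hX⟩ : ∃ X, X = (√s)⁻¹ * β := ⟨_, rfl⟩
  have hX0 : 0 ≤ X := by rw [hX]; positivity
  have hβX : β = √s * X := by rw [hX]; field_simp
  rw [← hX]
  have h1 : gk d c s β ≤ M * Real.exp c * s ^ (-(d:ℝ)/2) * (1 + X) ^ (-e) := by
    have h2 := h ((1+X)^2) (by nlinarith)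
    have h3 : (1/(1+X)^2) ^ (e/2) = (1+X) ^ (-e) := by
      rw [one_div, Real.inv_rpow (by positivity), ← Real.rpow_natCast, ← Real.rpow_mul (by positivity),
        Real.rpow_neg (by positivity)]
      congr 2; push_cast; ring
    rw [h3] at h2
    have h4 : Real.exp (-c * β^2/s) ≤ Real.exp c * Real.exp (-(c/2) * (1+X)^2) := by
      rw [← Real.exp_add]
      apply Real.exp_le_exp.mpr
      have : β^2/s = X^2 := by rw [hβX, mul_pow, Real.sq_sqrt hs.le]; field_simp
      rw [mul_div_assoc, this]
      nlinarith [mul_nonneg hc.le (sq_nonneg (1 - X))]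
    unfold gk
    calc _ ≤ s ^ (-(d:ℝ)/2) * (Real.exp c * (M * (1+X)^(-e))) := by
          gcongr s ^ (-(d:ℝ)/2) * ?_
          refine h4.trans ?_
          gcongr
      _ = _ := by ring
  have h5 : et e s β ≤ s ^ (-(d:ℝ)/2) * (1 + X) ^ (-e) := by
    unfold et
    have : s ^ ((1:ℝ)/2) + β = s ^ ((1:ℝ)/2) * (1+X) := by
      rw [hβX, Real.sqrt_eq_rpow]; ring
    rw [this, Real.mul_rpow (by positivity) (by positivity), Real.rpow_neg (by positivity),
      ← div_eq_mul_inv, ← div_div]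
    gcongr
    calc s / (s ^ ((1:ℝ)/2)) ^ e = s ^ (1 - e/2) := by
          rw [← Real.rpow_mul hs.le, Real.rpow_sub hs, Real.rpow_one]; congr 2; ring
      _ ≤ _ := Real.rpow_le_rpow_of_exponent_ge hs hs1 (by linarith)
  unfold Q
  have : 0 ≤ s ^ (-(d:ℝ)/2) * (1 + X) ^ (-e) := by positivity
  linarith

lemma mass (d : ℕ) (α c : ℝ) (hα : 0 < α) (hα2 : α < 2) (hc : 0 < c) :
    ∃ K : ℝ, 0 ≤ K ∧ ∀ s : ℝ, 0 < s → s ≤ 1 →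
      ∫⁻ z : EuclideanSpace ℝ (Fin d), ENNReal.ofReal (Q d (d+α) c s ‖z‖) ≤ ENNReal.ofReal K := by
  obtain ⟨M, hM, h⟩ := Q_bound d (d+α) c (by positivity) (by linarith) hc
  have hint : Integrable (fun z : EuclideanSpace ℝ (Fin d) => (1 + ‖z‖) ^ (-((d:ℝ)+α))) :=
    integrable_one_add_norm (by simp [hα])
  refine ⟨M * ∫ z : EuclideanSpace ℝ (Fin d), (1 + ‖z‖) ^ (-((d:ℝ)+α)), ?_, ?_⟩
  · exact mul_nonneg hM.le (integral_nonneg fun z => by positivity)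
  intro s hs hs1
  have hq : 0 < √s := Real.sqrt_pos.mpr hs
  have h1 : ∀ z : EuclideanSpace ℝ (Fin d), Q d (d+α) c s ‖z‖ ≤
      M * s ^ (-(d:ℝ)/2) * (1 + ‖(√s)⁻¹ • z‖) ^ (-((d:ℝ)+α)) := by
    intro z
    have := h s ‖z‖ hs hs1 (norm_nonneg _)
    rwa [norm_smul, Real.norm_of_nonneg (by positivity)]
  calc _ ≤ ∫⁻ z : EuclideanSpace ℝ (Fin d), ENNReal.ofReal
        (M * s ^ (-(d:ℝ)/2) * (1 + ‖(√s)⁻¹ • z‖) ^ (-((d:ℝ)+α))) :=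
        lintegral_mono fun z => ENNReal.ofReal_le_ofReal (h1 z)
    _ = ENNReal.ofReal (∫ z : EuclideanSpace ℝ (Fin d),
        (M * s ^ (-(d:ℝ)/2) * (1 + ‖(√s)⁻¹ • z‖) ^ (-((d:ℝ)+α)))) := by
        rw [ofReal_integral_eq_lintegral_ofReal]
        · exact (hint.comp_smul (R := (√s)⁻¹) (by positivity)).const_mul _
        · exact Filter.Eventually.of_forall fun z => by positivity
    _ = _ := by
        rw [integral_const_mul, Measure.integral_comp_inv_smul_of_nonneg volume
          (fun z : EuclideanSpace ℝ (Fin d) => (1 + ‖z‖) ^ (-((d:ℝ)+α))) hq.le]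
        congr 1
        rw [smul_eq_mul, finrank_euclideanSpace, Fintype.card_fin]
        have : s ^ (-(d:ℝ)/2) * (√s) ^ d = 1 := by
          rw [Real.sqrt_eq_rpow, ← Real.rpow_natCast, ← Real.rpow_mul hs.le, ← Real.rpow_add hs]
          have : -(d:ℝ)/2 + 1/2 * (d:ℝ) = 0 := by ring
          rw [this, Real.rpow_zero]
        linear_combination (M * ∫ z : EuclideanSpace ℝ (Fin d), (1 + ‖z‖) ^ (-((d:ℝ)+α))) * this

lemma Q_meas (d : ℕ) (e c : ℝ) : Measurable (fun q : ℝ × ℝ => Q d e c q.1 q.2) := by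
  unfold Q gk et
  fun_prop

lemma rev (t : ℝ) (H : ℝ → ℝ≥0∞) : ∫⁻ s in Ioo 0 t, H (t - s) = ∫⁻ s in Ioo 0 t, H s := by
  rw [← lintegral_indicator measurableSet_Ioo, ← lintegral_indicator measurableSet_Ioo,
    ← lintegral_sub_left_eq_self ((Ioo 0 t).indicator H) t]
  congr 1
  ext s
  simp only [indicator, mem_Ioo, sub_pos, sub_lt_self_iff, sub_sub_cancel]
  congr 1
  exact propext and_comm

set_option maxHeartbeats 2000000 in
theorem main (d : ℕ) (α : ℝ) (hα1 : 0 < α) (hα2 : α < 2)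
    (C c : ℝ) (hC : 1 ≤ C) (hc : 0 < c) :
    ∃ M₂ : ℝ, 0 < M₂ ∧
      ∀ p : ℝ → EuclideanSpace ℝ (Fin d) → EuclideanSpace ℝ (Fin d) → ℝ,
        (∀ t ∈ Set.Ioc (0 : ℝ) 1, ∀ x y,
          p t x y ≤ C * Q d (d+α) (3*c) t ‖x - y‖) →
        ∀ (G : EuclideanSpace ℝ (Fin d) → EuclideanSpace ℝ (Fin d) → ℝ),
          Measurable (Function.uncurry G) → (∀ z w, 0 ≤ G z w) →
          ∀ B : ℝ, (∀ z w, G z w ≤ B) →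
          ∀ t ∈ Set.Ioc (0 : ℝ) 1, ∀ x y : EuclideanSpace ℝ (Fin d),
            (∫⁻ s in Set.Ioc (0 : ℝ) t,
                ∫⁻ zw : EuclideanSpace ℝ (Fin d) × EuclideanSpace ℝ (Fin d),
                  ENNReal.ofReal (p (t - s) x zw.1 * Q d (d+α) (2*c) s ‖zw.2 - y‖ *
                    G zw.1 zw.2 / ‖zw.1 - zw.2‖ ^ ((d : ℝ) + α)))
              ≤ ENNReal.ofReal (M₂ * Q d (d+α) (2*c) t ‖x-y‖) *
                  (NF d α c G t +
                    ENNReal.ofReal B *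
                      (if t ^ ((1 : ℝ) / 2) < ‖x - y‖ then (1 : ℝ≥0∞) else 0)) := by
  obtain ⟨M, hM, hkey⟩ := key d (d+α) c (by positivity) (by linarith) hc
  obtain ⟨K, hK, hmass⟩ := mass d α c hα1 hα2 hc
  have hC0 : 0 < C := by linarith
  refine ⟨C * M * (2 + K^2), by positivity, ?_⟩
  intro p hp G hGm hG0 B hGB t ht x y
  obtain ⟨ht0, ht1⟩ := ht
  obtain ⟨T, hT⟩ : ∃ T, T = Q d (d+α) (2*c) t ‖x-y‖ := ⟨_, rfl⟩
  have hT0 : 0 ≤ T := by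
    rw [hT]; unfold Q; exact add_nonneg (gk_pos ht0).le (et_pos ht0 (norm_nonneg _)).le
  have hB0 : 0 ≤ B := (hG0 x x).trans (hGB x x)
  have hQ0 : ∀ k s (z : EuclideanSpace ℝ (Fin d)), 0 < s → 0 ≤ Q d (d+α) k s ‖z‖ := by
    intro k s z hs
    unfold Q; exact add_nonneg (gk_pos hs).le (et_pos hs (norm_nonneg _)).le
  obtain ⟨ι, hι⟩ : ∃ ι : ℝ, ι = if t ^ ((1 : ℝ) / 2) < ‖x - y‖ then 1 else 0 := ⟨_, rfl⟩
  have hι0 : 0 ≤ ι := by rw [hι]; split_ifs <;> norm_num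
  have hιE : (if t ^ ((1 : ℝ) / 2) < ‖x - y‖ then (1 : ℝ≥0∞) else 0) = ENNReal.ofReal ι := by
    rw [hι]; split_ifs <;> simp
  rw [← hT, hιE]
  let F1 : ℝ → EuclideanSpace ℝ (Fin d) × EuclideanSpace ℝ (Fin d) → ℝ≥0∞ := fun u zw =>
    ENNReal.ofReal (Q d (d+α) c u ‖x - zw.1‖ * G zw.1 zw.2 / ‖zw.1 - zw.2‖ ^ ((d : ℝ) + α))
  let F2 : ℝ → EuclideanSpace ℝ (Fin d) × EuclideanSpace ℝ (Fin d) → ℝ≥0∞ := fun s zw =>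
    ENNReal.ofReal (Q d (d+α) c s ‖zw.2 - y‖ * G zw.1 zw.2 / ‖zw.1 - zw.2‖ ^ ((d : ℝ) + α))
  have hGm' : Measurable fun zw : EuclideanSpace ℝ (Fin d) × EuclideanSpace ℝ (Fin d) =>
    G zw.1 zw.2 := hGm
  have hQm := Q_meas d (d+α) c
  have mF1 : Measurable (Function.uncurry F1) := by
    refine ENNReal.measurable_ofReal.comp (Measurable.div (Measurable.mul ?_ ?_) ?_)
    · exact hQm.comp (measurable_fst.prodMk (by fun_prop))
    · exact hGm'.comp measurable_snd
    · fun_prop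
  have mF2 : Measurable (Function.uncurry F2) := by
    refine ENNReal.measurable_ofReal.comp (Measurable.div (Measurable.mul ?_ ?_) ?_)
    · exact hQm.comp (measurable_fst.prodMk (by fun_prop))
    · exact hGm'.comp measurable_snd
    · fun_prop
  have mF1' : ∀ s, Measurable (F1 s) := fun s => mF1.comp measurable_prodMk_left
  have mF2' : ∀ s, Measurable (F2 s) := fun s => mF2.comp measurable_prodMk_left
  have mI1 : Measurable fun s => ∫⁻ zw, F1 s zw := mF1.lintegral_prod_right'
  have mI2 : Measurable fun s => ∫⁻ zw, F2 s zw := mF2.lintegral_prod_right'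
  -- bounds by NF
  have hN1 : ∫⁻ s in Ioo 0 t, ∫⁻ zw, F1 s zw ≤ NF d α c G t := by
    unfold NF
    refine le_trans ?_ (le_iSup _ x)
    refine le_trans (lintegral_mono_set Ioo_subset_Ioc_self) ?_
    refine setLIntegral_mono' measurableSet_Ioc fun s hs => lintegral_mono fun zw => ?_
    refine ENNReal.ofReal_le_ofReal ?_
    have := hQ0 c s (x - zw.1) hs.1
    change Q d (d+α) c s ‖x - zw.1‖ * _ / _ ≤ Q d (d+α) c s ‖x - zw.1‖ * _ / _
    gcongr
    linarith [hG0 zw.2 zw.1]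
  have hN2 : ∫⁻ s in Ioo 0 t, ∫⁻ zw, F2 s zw ≤ NF d α c G t := by
    unfold NF
    refine le_trans ?_ (le_iSup _ y)
    refine le_trans (lintegral_mono_set Ioo_subset_Ioc_self) ?_
    refine setLIntegral_mono' measurableSet_Ioc fun s hs => ?_
    rw [Measure.volume_eq_prod, ← lintegral_prod_swap]
    refine lintegral_mono fun zw => ?_
    refine ENNReal.ofReal_le_ofReal ?_
    have := hQ0 c s (y - zw.1) hs.1
    change Q d (d+α) c s ‖zw.1 - y‖ * G zw.2 zw.1 / ‖zw.2 - zw.1‖ ^ ((d:ℝ)+α)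
      ≤ Q d (d+α) c s ‖y - zw.1‖ * _ / _
    rw [norm_sub_rev zw.1 y, norm_sub_rev zw.2 zw.1]
    gcongr
    linarith [hG0 zw.1 zw.2]
  -- pointwise in s
  have hs_bound : ∀ s ∈ Ioo 0 t, ∫⁻ zw : EuclideanSpace ℝ (Fin d) × EuclideanSpace ℝ (Fin d),
                  ENNReal.ofReal (p (t - s) x zw.1 * Q d (d+α) (2*c) s ‖zw.2 - y‖ *
                    G zw.1 zw.2 / ‖zw.1 - zw.2‖ ^ ((d : ℝ) + α))
      ≤ ENNReal.ofReal (C * M * T) * ((∫⁻ zw, F1 (t-s) zw) + ∫⁻ zw, F2 s zw)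
        + ENNReal.ofReal (C * M * (T / t) * B * ι) * (ENNReal.ofReal K * ENNReal.ofReal K) := by
    intro s hs
    have hu0 : 0 < t - s := by linarith [hs.2]
    let F3 : EuclideanSpace ℝ (Fin d) × EuclideanSpace ℝ (Fin d) → ℝ≥0∞ := fun zw =>
      ENNReal.ofReal (Q d (d+α) c (t-s) ‖x - zw.1‖) * ENNReal.ofReal (Q d (d+α) c s ‖zw.2 - y‖)
    have ma : Measurable fun z : EuclideanSpace ℝ (Fin d) =>
        ENNReal.ofReal (Q d (d+α) c (t-s) ‖x - z‖) :=
      ENNReal.measurable_ofReal.comp (hQm.comp (measurable_const.prodMk (by fun_prop)))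
    have mb : Measurable fun z : EuclideanSpace ℝ (Fin d) =>
        ENNReal.ofReal (Q d (d+α) c s ‖z - y‖) :=
      ENNReal.measurable_ofReal.comp (hQm.comp (measurable_const.prodMk (by fun_prop)))
    have hF3 : ∫⁻ zw, F3 zw ≤ ENNReal.ofReal K * ENNReal.ofReal K := by
      rw [Measure.volume_eq_prod, lintegral_prod_mul ma.aemeasurable mb.aemeasurable]
      rw [lintegral_sub_left_eq_self (fun z => ENNReal.ofReal (Q d (d+α) c (t-s) ‖z‖)) x,
        lintegral_sub_right_eq_self (fun z => ENNReal.ofReal (Q d (d+α) c s ‖z‖)) y]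
      gcongr
      · exact hmass _ hu0 (by linarith [hs.1])
      · exact hmass _ hs.1 (by linarith [hs.2])
    have hpt : ∀ zw : EuclideanSpace ℝ (Fin d) × EuclideanSpace ℝ (Fin d),
        ENNReal.ofReal (p (t - s) x zw.1 * Q d (d+α) (2*c) s ‖zw.2 - y‖ *
                    G zw.1 zw.2 / ‖zw.1 - zw.2‖ ^ ((d : ℝ) + α)) ≤
        ENNReal.ofReal (C * M * T) * (F1 (t-s) zw + F2 s zw)
          + ENNReal.ofReal (C * M * (T / t) * B * ι) * F3 zw := by
      rintro ⟨z, w⟩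
      have k := hkey t s (t-s) ‖x-y‖ ‖x-z‖ ‖w-y‖ ‖z-w‖ hs.1 hu0 (by ring) ht1 (norm_nonneg _)
        (norm_nonneg _) (norm_nonneg _) (norm_nonneg _) (by
          have : x - y = (x - z) + (z - w) + (w - y) := by abel
          rw [this]; exact norm_add₃_le)
      rw [← hT] at k
      have hpp := hp (t-s) ⟨hu0, by linarith [hs.1]⟩ x z
      have P0 := hQ0 c (t-s) (x-z) hu0
      have P0' := hQ0 c s (w-y) hs.1
      have R0 := hQ0 (2*c) s (w-y) hs.1
      have hG := hG0 z w
      have hGb := hGB z w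
      have hif : (if t ^ ((1:ℝ)/2) < ‖x-y‖ then T / t * ‖z-w‖ ^ ((d:ℝ)+α) *
          (Q d (d+α) c (t-s) ‖x-z‖ * Q d (d+α) c s ‖w-y‖) else 0) =
          ι * (T / t * ‖z-w‖ ^ ((d:ℝ)+α) *
          (Q d (d+α) c (t-s) ‖x-z‖ * Q d (d+α) c s ‖w-y‖)) := by
        rw [hι]; split_ifs <;> simp
      rw [hif] at k
      simp only [F1, F2, F3]
      obtain ⟨P, hP⟩ : ∃ P, P = Q d (d+α) c (t-s) ‖x-z‖ := ⟨_, rfl⟩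
      obtain ⟨P', hP'⟩ : ∃ P', P' = Q d (d+α) c s ‖w-y‖ := ⟨_, rfl⟩
      obtain ⟨R, hR⟩ : ∃ R, R = Q d (d+α) (2*c) s ‖w-y‖ := ⟨_, rfl⟩
      obtain ⟨S, hS⟩ : ∃ S, S = Q d (d+α) (3*c) (t-s) ‖x-z‖ := ⟨_, rfl⟩
      obtain ⟨D, hD⟩ : ∃ D, D = ‖z-w‖ ^ ((d:ℝ)+α) := ⟨_, rfl⟩
      have D0 : 0 ≤ D := by rw [hD]; positivity
      simp only [← hP, ← hP', ← hR, ← hS, ← hD] at *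
      rw [← ENNReal.ofReal_add (by positivity) (by positivity), ← ENNReal.ofReal_mul (by positivity),
        ← ENNReal.ofReal_mul (by positivity), ← ENNReal.ofReal_mul (by positivity),
        ← ENNReal.ofReal_add (by positivity) (by positivity)]
      refine ENNReal.ofReal_le_ofReal ?_
      have hDD : D * (G z w / D) ≤ B := by
        by_cases h : D = 0
        · simp [h, hB0]
        · rw [mul_div_cancel₀ _ h]; exact hGb
      calc p (t-s) x z * R * G z w / D = p (t-s) x z * R * (G z w / D) := by ring
        _ ≤ (C * S) * R * (G z w / D) := by gcongr
        _ = C * (S * R) * (G z w / D) := by ring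
        _ ≤ C * (M * (T * (P + P') + ι * (T / t * D * (P * P')))) * (G z w / D) := by gcongr
        _ = C * M * T * (P * G z w / D + P' * G z w / D)
            + C * M * (T / t) * ι * (P * P') * (D * (G z w / D)) := by ring
        _ ≤ C * M * T * (P * G z w / D + P' * G z w / D)
            + C * M * (T / t) * ι * (P * P') * B := by gcongr
        _ = _ := by ring
    calc _ ≤ ∫⁻ zw, (ENNReal.ofReal (C * M * T) * (F1 (t-s) zw + F2 s zw)
          + ENNReal.ofReal (C * M * (T / t) * B * ι) * F3 zw) := lintegral_mono hpt
      _ = ENNReal.ofReal (C * M * T) * ((∫⁻ zw, F1 (t-s) zw) + ∫⁻ zw, F2 s zw)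
        + ENNReal.ofReal (C * M * (T / t) * B * ι) * ∫⁻ zw, F3 zw := by
          have hm : Measurable (fun zw => ENNReal.ofReal (C * M * T) * (F1 (t-s) zw + F2 s zw)) :=
            ((mF1' _).add (mF2' _)).const_mul _
          rw [lintegral_add_left hm,
            lintegral_const_mul' _ _ ENNReal.ofReal_ne_top,
            lintegral_const_mul' _ _ ENNReal.ofReal_ne_top,
            lintegral_add_left (mF1' _)]
      _ ≤ _ := by gcongr
  rw [setLIntegral_congr (Ioo_ae_eq_Ioc (μ := volume) (a := (0:ℝ)) (b := t)).symm]
  calc _ ≤ ∫⁻ s in Ioo 0 t, (ENNReal.ofReal (C * M * T) * ((∫⁻ zw, F1 (t-s) zw) + ∫⁻ zw, F2 s zw)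
        + ENNReal.ofReal (C * M * (T / t) * B * ι) * (ENNReal.ofReal K * ENNReal.ofReal K)) :=
        setLIntegral_mono' measurableSet_Ioo hs_bound
    _ = ENNReal.ofReal (C * M * T) * ((∫⁻ s in Ioo 0 t, ∫⁻ zw, F1 s zw) +
          ∫⁻ s in Ioo 0 t, ∫⁻ zw, F2 s zw) + ENNReal.ofReal (C * M * (T / t) * B * ι) *
          (ENNReal.ofReal K * ENNReal.ofReal K) * ENNReal.ofReal t := by
        rw [lintegral_add_right _ measurable_const,
          lintegral_const_mul' _ _ ENNReal.ofReal_ne_top, lintegral_add_right _ mI2,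
          rev t (fun s => ∫⁻ zw, F1 s zw), setLIntegral_const, Real.volume_Ioo, sub_zero]
    _ ≤ ENNReal.ofReal (C * M * T) * (NF d α c G t + NF d α c G t) +
          ENNReal.ofReal (C * M * T * K^2) * (ENNReal.ofReal B * ENNReal.ofReal ι) := by
        refine add_le_add (by gcongr) (le_of_eq ?_)
        rw [← ENNReal.ofReal_mul hK, ← ENNReal.ofReal_mul (by positivity),
          ← ENNReal.ofReal_mul (by positivity), ← ENNReal.ofReal_mul (by positivity),
          ← ENNReal.ofReal_mul (by positivity)]
        congr 1
        field_simp
    _ = ENNReal.ofReal (2 * (C * M * T)) * NF d α c G t +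
          ENNReal.ofReal (C * M * T * K^2) * (ENNReal.ofReal B * ENNReal.ofReal ι) := by
        congr 1
        have h2 : ENNReal.ofReal (2 * (C * M * T)) = 2 * ENNReal.ofReal (C * M * T) := by
          rw [ENNReal.ofReal_mul (p := 2) (by norm_num), ENNReal.ofReal_ofNat]
        rw [h2, ← two_mul]
        ring
    _ ≤ ENNReal.ofReal (C * M * (2 + K^2) * T) * NF d α c G t +
          ENNReal.ofReal (C * M * (2 + K^2) * T) * (ENNReal.ofReal B * ENNReal.ofReal ι) := by
        have h0 : 0 ≤ C * M * T := by positivity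
        have i1 : 2 * (C * M * T) ≤ C * M * (2 + K^2) * T := by
          nlinarith [mul_nonneg h0 (sq_nonneg K)]
        have i2 : C * M * T * K^2 ≤ C * M * (2 + K^2) * T := by nlinarith
        exact add_le_add (mul_le_mul' (ENNReal.ofReal_le_ofReal i1) le_rfl)
          (mul_le_mul' (ENNReal.ofReal_le_ofReal i2) le_rfl)
    _ = _ := (mul_add _ _ _).symm

end P14

/-- generalized integral 3P inequality for the heat kernel `p`,
with `B` any uniform upper bound of `G` (in particular `B = ‖G‖_∞`). -/
theorem stmt14 (d : ℕ) (hd : 2 ≤ d) (α : ℝ) (hα1 : 0 < α) (hα2 : α < 2)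
    (C lam : ℝ) (hC : 1 ≤ C) (hlam : 0 < lam) :
    ∃ M₂ : ℝ, 0 < M₂ ∧
      ∀ p : ℝ → EuclideanSpace ℝ (Fin d) → EuclideanSpace ℝ (Fin d) → ℝ,
        Measurable (fun q : ℝ × EuclideanSpace ℝ (Fin d) × EuclideanSpace ℝ (Fin d) =>
          p q.1 q.2.1 q.2.2) →
        (∀ t ∈ Set.Ioc (0 : ℝ) 1, ∀ x y, 0 ≤ p t x y) →
        (∀ t ∈ Set.Ioc (0 : ℝ) 1, ∀ x y,
          p t x y ≤ C * (Gam d lam t (x - y) + eta d α t (x - y))) →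
        ∀ (G : EuclideanSpace ℝ (Fin d) → EuclideanSpace ℝ (Fin d) → ℝ),
          Measurable (Function.uncurry G) → (∀ z w, 0 ≤ G z w) →
          ∀ B : ℝ, (∀ z w, G z w ≤ B) →
          ∀ t ∈ Set.Ioc (0 : ℝ) 1, ∀ x y : EuclideanSpace ℝ (Fin d),
            (∫⁻ s in Set.Ioc (0 : ℝ) t,
                ∫⁻ zw : EuclideanSpace ℝ (Fin d) × EuclideanSpace ℝ (Fin d),
                  ENNReal.ofReal (p (t - s) x zw.1 * pc d α (2 * lam / 3) s zw.2 y *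
                    G zw.1 zw.2 / ‖zw.1 - zw.2‖ ^ ((d : ℝ) + α)))
              ≤ ENNReal.ofReal (M₂ * pc d α (2 * lam / 3) t x y) *
                  (NF d α (lam / 3) G t +
                    ENNReal.ofReal B *
                      (if t ^ ((1 : ℝ) / 2) < ‖x - y‖ then (1 : ℝ≥0∞) else 0)) := by
  obtain ⟨M, hM, h⟩ := P14.main d α hα1 hα2 C (lam/3) hC (by positivity)
  refine ⟨M, hM, ?_⟩
  intro p _ _ hp G hGm hG0 B hGB t ht x y
  have e3 : 3 * (lam/3) = lam := by ring
  have e2 : 2 * (lam/3) = 2 * lam / 3 := by ring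
  rw [e3, e2] at h
  exact h p hp G hGm hG0 B hGB t ht x y
end

section
/- Let a > 0. There exists a constant C' > 0, depending only on d, α, a, such that for every t ∈ (0,2) and all x, y ∈ ℝ^d, ∫_{ℝ^d} p_a(t/2, x, z)·p_a(t/2, z, y) dz ≤ C'·p_a(t, x, y). -/
open MeasureTheory Set ENNReal

lemma aux_exp (a δ : ℝ) (ha : 0 < a) (hδ : 0 < δ) (v : ℝ) (hv : 0 ≤ v) :
    Real.exp (-a * v ^ 2) ≤ Real.exp (δ ^ 2 / (4 * a)) * (1 + v) ^ (-δ) := by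
  have h1 : (1 + v) ^ δ ≤ Real.exp (δ * v) := by
    have : (1 + v) ≤ Real.exp v := by linarith [Real.add_one_le_exp v]
    calc (1 + v) ^ δ ≤ (Real.exp v) ^ δ := Real.rpow_le_rpow (by linarith) this hδ.le
      _ = _ := by rw [← Real.exp_mul, mul_comm]
  have h2 : 0 < (1 + v) ^ δ := Real.rpow_pos_of_pos (by linarith) _
  rw [Real.rpow_neg (by linarith), ← div_eq_mul_inv, le_div_iff₀ h2]
  calc Real.exp (-a * v ^ 2) * (1 + v) ^ δ
      ≤ Real.exp (-a * v ^ 2) * Real.exp (δ * v) := by gcongr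
    _ = Real.exp (-a * v ^ 2 + δ * v) := by rw [Real.exp_add]
    _ ≤ _ := by
      apply Real.exp_le_exp.2
      rw [le_div_iff₀ (by positivity)]
      nlinarith [sq_nonneg (2 * a * v - δ)]

lemma aux_w (δ : ℝ) (hδ : 0 < δ) (p q r : ℝ) (hp : 0 ≤ p) (hq : 0 ≤ q) (hr : 0 ≤ r)
    (h : r ≤ p + q) :
    (1 + p) ^ (-δ) * (1 + q) ^ (-δ) ≤
      2 ^ δ * (1 + r) ^ (-δ) * ((1 + p) ^ (-δ) + (1 + q) ^ (-δ)) := by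
  have key : ∀ m : ℝ, 0 ≤ m → r ≤ 2 * m → (1 + m) ^ (-δ) ≤ 2 ^ δ * (1 + r) ^ (-δ) := by
    intro m hm hrm
    have : (1 + r) ^ δ ≤ 2 ^ δ * (1 + m) ^ δ := by
      rw [← Real.mul_rpow (by norm_num) (by linarith)]
      exact Real.rpow_le_rpow (by linarith) (by linarith) hδ.le
    rw [Real.rpow_neg (by linarith), Real.rpow_neg (by linarith), ← div_eq_mul_inv,
      le_div_iff₀ (by positivity), inv_mul_le_iff₀ (by positivity)]
    linarith
  have P : 0 < (1 + p) ^ (-δ) := by positivity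
  have Q : 0 < (1 + q) ^ (-δ) := by positivity
  have R : 0 < 2 ^ δ * (1 + r) ^ (-δ) := by positivity
  rcases le_total p q with hpq | hpq
  · have := key q hq (by linarith)
    nlinarith [mul_le_mul_of_nonneg_left this P.le, mul_pos R Q]
  · have := key p hp (by linarith)
    nlinarith [mul_le_mul_of_nonneg_left this Q.le, mul_pos R P]

lemma aux_int_s16 (d : ℕ) (δ : ℝ) (hδ : (d : ℝ) < δ) (h : ℝ) (hh : 0 < h)
    (c : EuclideanSpace ℝ (Fin d)) :
    ∫⁻ z, ENNReal.ofReal ((1 + ‖z - c‖ / h) ^ (-δ)) =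
      ENNReal.ofReal (h ^ d * ∫ z : EuclideanSpace ℝ (Fin d), (1 + ‖z‖) ^ (-δ)) := by
  have hI : Integrable (fun z : EuclideanSpace ℝ (Fin d) => (1 + ‖z‖) ^ (-δ)) :=
    integrable_one_add_norm (by simpa using hδ)
  have hI2 := hI.comp_smul (R := h⁻¹) (by positivity)
  rw [lintegral_sub_right_eq_self
    (fun z : EuclideanSpace ℝ (Fin d) => ENNReal.ofReal ((1 + ‖z‖ / h) ^ (-δ))) c]
  have e : ∀ z : EuclideanSpace ℝ (Fin d), ‖z‖ / h = ‖h⁻¹ • z‖ := by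
    intro z
    rw [norm_smul, Real.norm_of_nonneg (by positivity)]; field_simp
  simp_rw [e]
  rw [← ofReal_integral_eq_lintegral_ofReal hI2
    (Filter.Eventually.of_forall fun z => by positivity),
    Measure.integral_comp_smul volume
      (fun z : EuclideanSpace ℝ (Fin d) => (1 + ‖z‖) ^ (-δ))]
  congr 1
  simp [abs_of_pos hh]

lemma Gam_eq (d : ℕ) (a h : ℝ) (hh : 0 < h) (v : EuclideanSpace ℝ (Fin d)) :
    Gam d a (h ^ 2) v = (h ^ d)⁻¹ * Real.exp (-a * (‖v‖ / h) ^ 2) := by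
  unfold Gam
  congr 1
  · rw [← Real.rpow_natCast h 2, ← Real.rpow_mul hh.le, ← Real.rpow_natCast h d,
      ← Real.rpow_neg hh.le]
    congr 1; push_cast; ring
  · congr 1; field_simp

lemma eta_eq (d : ℕ) (α h : ℝ) (hh : 0 < h) (v : EuclideanSpace ℝ (Fin d)) :
    eta d α (h ^ 2) v =
      h ^ 2 * h ^ (-((d : ℝ) + α)) * (1 + ‖v‖ / h) ^ (-((d : ℝ) + α)) := by
  unfold eta
  have : (h ^ 2) ^ ((1 : ℝ) / 2) = h := by
    rw [← Real.sqrt_eq_rpow, Real.sqrt_sq hh.le]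
  rw [this, mul_assoc, ← Real.mul_rpow hh.le (by positivity), mul_add, mul_div_cancel₀ _ hh.ne',
    mul_one, Real.rpow_neg (by positivity), div_eq_mul_inv]

lemma Gam_eq2 (d : ℕ) (a h : ℝ) (hh : 0 < h) (v : EuclideanSpace ℝ (Fin d)) :
    (h ^ d)⁻¹ * Real.exp (-a * (‖v‖ / h) ^ 2 / 2) ≤ 2 ^ d * Gam d a (2 * h ^ 2) v := by
  have e : 2 * h ^ 2 = (Real.sqrt 2 * h) ^ 2 := by rw [mul_pow, Real.sq_sqrt (by norm_num)]
  rw [e, Gam_eq d a _ (by positivity)]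
  have e2 : -a * (‖v‖ / (Real.sqrt 2 * h)) ^ 2 = -a * (‖v‖ / h) ^ 2 / 2 := by
    rw [div_pow, mul_pow, Real.sq_sqrt (by norm_num)]; field_simp
  rw [e2, ← mul_assoc]
  gcongr
  rw [mul_pow, mul_inv, ← mul_assoc]
  have : (1 : ℝ) ≤ 2 ^ d * (Real.sqrt 2 ^ d)⁻¹ := by
    rw [← div_eq_mul_inv, one_le_div (by positivity)]
    gcongr
    rw [Real.sqrt_le_left (by norm_num)]; norm_num
  have h0 : 0 < (h ^ d)⁻¹ := by positivity
  nlinarith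

lemma eta_eq2 (d : ℕ) (α h : ℝ) (hα : 0 < α) (hh : 0 < h) (v : EuclideanSpace ℝ (Fin d)) :
    h ^ 2 * h ^ (-((d : ℝ) + α)) * (1 + ‖v‖ / h) ^ (-((d : ℝ) + α)) ≤
      2 ^ ((d : ℝ) + α) * eta d α (2 * h ^ 2) v := by
  rw [← eta_eq d α h hh]
  unfold eta
  have e1 : (h ^ 2) ^ ((1 : ℝ) / 2) = h := by
    rw [← Real.sqrt_eq_rpow, Real.sqrt_sq hh.le]
  have e2 : (2 * h ^ 2) ^ ((1 : ℝ) / 2) ≤ 2 * h := by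
    rw [← Real.sqrt_eq_rpow, Real.sqrt_le_left (by positivity)]; nlinarith
  rw [e1, mul_div_assoc', div_le_div_iff₀ (by positivity) (by positivity)]
  have : ((2 * h ^ 2) ^ ((1 : ℝ) / 2) + ‖v‖) ^ ((d : ℝ) + α) ≤
      2 ^ ((d : ℝ) + α) * (h + ‖v‖) ^ ((d : ℝ) + α) := by
    rw [← Real.mul_rpow (by norm_num) (by positivity)]
    apply Real.rpow_le_rpow (by positivity) _ (by positivity)
    linarith [norm_nonneg v]
  have h3 : 0 < 2 ^ ((d : ℝ) + α) * (h + ‖v‖) ^ ((d : ℝ) + α) := by positivity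
  have h4 : 0 < h ^ 2 := by positivity
  nlinarith [mul_le_mul_of_nonneg_left this h4.le, mul_pos h4 h3]

lemma aux_par (d : ℕ) (h : ℝ) (hh : 0 < h) (x y z : EuclideanSpace ℝ (Fin d)) :
    (‖x - z‖ / h) ^ 2 + (‖z - y‖ / h) ^ 2 =
      (‖x - y‖ / h) ^ 2 / 2 + 2 * (‖z - (1 / 2 : ℝ) • (x + y)‖ / h) ^ 2 := by
  have par := parallelogram_law_with_norm ℝ (x - z) (z - y)
  have p1 : x - z + (z - y) = x - y := by abel
  have p2 : x - z - (z - y) = (-2 : ℝ) • (z - (1 / 2 : ℝ) • (x + y)) := by module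
  have p3 : ‖(-2 : ℝ)‖ = 2 := by norm_num
  rw [p1, p2, norm_smul, p3] at par
  simp only [div_pow]
  field_simp
  linarith

set_option maxHeartbeats 1000000 in
/-- Chapman-Kolmogorov-type upper bound for p_a. -/
theorem stmt16 (d : ℕ) (hd : 2 ≤ d) (α : ℝ) (hα1 : 0 < α) (hα2 : α < 2)
    (a : ℝ) (ha : 0 < a) :
    ∃ C' : ℝ, 0 < C' ∧
      ∀ t ∈ Set.Ioo (0 : ℝ) 2, ∀ x y : EuclideanSpace ℝ (Fin d),
        (∫⁻ z, ENNReal.ofReal (pc d α a (t / 2) x z * pc d α a (t / 2) z y))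
          ≤ ENNReal.ofReal (C' * pc d α a t x y) := by
  set δ : ℝ := (d : ℝ) + α with hδdef
  have hδ : 0 < δ := by positivity
  set C : ℝ := Real.exp (δ ^ 2 / (4 * a)) with hC
  have hCpos : 0 < C := Real.exp_pos _
  set W : ℝ := ∫ z : EuclideanSpace ℝ (Fin d), (1 + ‖z‖) ^ (-δ) with hW
  have hW0 : 0 ≤ W := integral_nonneg fun z => by positivity
  refine ⟨C * W * 2 ^ d + (2 * C + 1) * 2 ^ δ * 2 * W * 2 ^ δ + 1, by positivity, ?_⟩
  rintro t ⟨ht0, ht2⟩ x y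
  obtain ⟨h, hh, hs⟩ : ∃ h : ℝ, 0 < h ∧ t / 2 = h ^ 2 :=
    ⟨Real.sqrt (t / 2), by positivity, (Real.sq_sqrt (by positivity)).symm⟩
  have ht : t = 2 * h ^ 2 := by linarith
  have hh1 : h ≤ 1 := by nlinarith
  have hG := Gam_eq2 d a h hh (x - y)
  have hE := eta_eq2 d α h hα1 hh (x - y)
  rw [hs]
  rw [ht]
  simp only [pc, Gam_eq d a h hh, eta_eq d α h hh]
  rw [← hδdef] at *
  set D : ℝ := (h ^ d)⁻¹ with hD
  set E : ℝ := h ^ 2 * h ^ (-δ) with hEdef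
  have hDpos : 0 < D := by positivity
  have hEpos : 0 < E := by positivity
  have hDh : D * h ^ d = 1 := inv_mul_cancel₀ (by positivity)
  have hED : E ≤ D := by
    have e1 : E = h ^ (2 - δ) := by
      rw [hEdef, ← Real.rpow_natCast h 2, ← Real.rpow_add hh]; norm_num [sub_eq_add_neg]
    have e2 : D = h ^ (-(d : ℝ)) := by
      rw [hD, ← Real.rpow_natCast h d, Real.rpow_neg hh.le]
    rw [e1, e2]
    apply Real.rpow_le_rpow_of_exponent_ge hh hh1
    rw [hδdef]; linarith
  set g : ℝ := Real.exp (-a * (‖x - y‖ / h) ^ 2 / 2) with hg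
  set w : ℝ := (1 + ‖x - y‖ / h) ^ (-δ) with hw
  have hgpos : 0 < g := Real.exp_pos _
  have hwpos : 0 < w := by positivity
  set m : EuclideanSpace ℝ (Fin d) := (1 / 2 : ℝ) • (x + y) with hm
  set K1 : ℝ := D ^ 2 * g * C with hK1
  set K2 : ℝ := D * E * (2 * C + 1) * (2 ^ δ * w) with hK2
  have hK1p : 0 ≤ K1 := by positivity
  have hK2p : 0 ≤ K2 := by positivity
  have hpt : ∀ z : EuclideanSpace ℝ (Fin d),
      (D * Real.exp (-a * (‖x - z‖ / h) ^ 2) + E * (1 + ‖x - z‖ / h) ^ (-δ)) *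
      (D * Real.exp (-a * (‖z - y‖ / h) ^ 2) + E * (1 + ‖z - y‖ / h) ^ (-δ)) ≤
      K1 * (1 + ‖z - m‖ / h) ^ (-δ) + (K2 * (1 + ‖z - x‖ / h) ^ (-δ)
        + K2 * (1 + ‖z - y‖ / h) ^ (-δ)) := by
    intro z
    rw [norm_sub_rev z x]
    have h1 := aux_exp a δ ha hδ (‖x - z‖ / h) (by positivity)
    have h2 := aux_exp a δ ha hδ (‖z - y‖ / h) (by positivity)
    have h3 := aux_exp a δ ha hδ (‖z - m‖ / h) (by positivity)
    have h4 := aux_w δ hδ (‖x - z‖ / h) (‖z - y‖ / h) (‖x - y‖ / h) (by positivity)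
      (by positivity) (by positivity)
      (by rw [← add_div]; gcongr; exact norm_sub_le_norm_sub_add_norm_sub x z y)
    have h5 : Real.exp (-a * (‖x - z‖ / h) ^ 2) * Real.exp (-a * (‖z - y‖ / h) ^ 2)
        ≤ g * (C * (1 + ‖z - m‖ / h) ^ (-δ)) := by
      refine le_trans ?_ (mul_le_mul_of_nonneg_left h3 hgpos.le)
      rw [hg, ← Real.exp_add, ← Real.exp_add]
      apply Real.exp_le_exp.2
      have q := aux_par d h hh x y z
      rw [← hm] at q
      have q2 : 0 ≤ a * (‖z - m‖ / h) ^ 2 := by positivity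
      have q3 := congrArg (fun r => a * r) q
      simp only [mul_add] at q3
      linarith
    rw [← hC] at h1 h2
    rw [← hw] at h4
    set e1 := Real.exp (-a * (‖x - z‖ / h) ^ 2)
    set e2 := Real.exp (-a * (‖z - y‖ / h) ^ 2)
    have hw1 : 0 < (1 + ‖x - z‖ / h) ^ (-δ) := by positivity
    have hw2 : 0 < (1 + ‖z - y‖ / h) ^ (-δ) := by positivity
    set w1 := (1 + ‖x - z‖ / h) ^ (-δ)
    set w2 := (1 + ‖z - y‖ / h) ^ (-δ)
    calc (D * e1 + E * w1) * (D * e2 + E * w2)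
        = D ^ 2 * (e1 * e2) + D * E * (e1 * w2 + w1 * e2) + E * E * (w1 * w2) := by ring
      _ ≤ D ^ 2 * (g * (C * (1 + ‖z - m‖ / h) ^ (-δ)))
          + D * E * ((C * w1) * w2 + w1 * (C * w2)) + D * E * (w1 * w2) := by gcongr
      _ = K1 * (1 + ‖z - m‖ / h) ^ (-δ) + D * E * (2 * C + 1) * (w1 * w2) := by
          rw [hK1]; ring
      _ ≤ K1 * (1 + ‖z - m‖ / h) ^ (-δ)
          + D * E * (2 * C + 1) * (2 ^ δ * w * (w1 + w2)) := by gcongr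
      _ = _ := by rw [hK2]; ring
  have hdδ : (d : ℝ) < δ := by rw [hδdef]; linarith
  have hmeas : ∀ (K : ℝ) (c : EuclideanSpace ℝ (Fin d)), Measurable
      (fun z : EuclideanSpace ℝ (Fin d) => ENNReal.ofReal (K * (1 + ‖z - c‖ / h) ^ (-δ))) := by
    intro K c
    fun_prop
  have hJint : ∀ (K : ℝ) (c : EuclideanSpace ℝ (Fin d)), 0 ≤ K →
      ∫⁻ z, ENNReal.ofReal (K * (1 + ‖z - c‖ / h) ^ (-δ)) =
        ENNReal.ofReal (K * (h ^ d * W)) := by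
    intro K c hK
    simp_rw [ENNReal.ofReal_mul hK]
    rw [lintegral_const_mul' _ _ ENNReal.ofReal_ne_top, aux_int_s16 d δ hdδ h hh c]
  calc _ ≤ ∫⁻ z, (ENNReal.ofReal (K1 * (1 + ‖z - m‖ / h) ^ (-δ)) +
        (ENNReal.ofReal (K2 * (1 + ‖z - x‖ / h) ^ (-δ))
        + ENNReal.ofReal (K2 * (1 + ‖z - y‖ / h) ^ (-δ)))) := by
        apply lintegral_mono
        intro z
        dsimp only
        rw [← ENNReal.ofReal_add (by positivity) (by positivity),
          ← ENNReal.ofReal_add (by positivity) (by positivity)]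
        exact ENNReal.ofReal_le_ofReal (hpt z)
    _ = ENNReal.ofReal (K1 * (h ^ d * W) + (K2 * (h ^ d * W) + K2 * (h ^ d * W))) := by
        rw [lintegral_add_left (hmeas _ _), lintegral_add_left (hmeas _ _), hJint _ _ hK1p,
          hJint _ _ hK2p, hJint _ _ hK2p, ← ENNReal.ofReal_add (by positivity) (by positivity),
          ← ENNReal.ofReal_add (by positivity) (by positivity)]
    _ ≤ _ := by
        apply ENNReal.ofReal_le_ofReal
        have hGp : 0 ≤ Gam d a (2 * h ^ 2) (x - y) := by unfold Gam; positivity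
        have hEp : 0 ≤ eta d α (2 * h ^ 2) (x - y) := by unfold eta; positivity
        set G := Gam d a (2 * h ^ 2) (x - y)
        set H := eta d α (2 * h ^ 2) (x - y)
        calc K1 * (h ^ d * W) + (K2 * (h ^ d * W) + K2 * (h ^ d * W))
            = (D * h ^ d) * (C * W * (D * g)
              + (2 * C + 1) * 2 ^ δ * 2 * W * (E * w)) := by rw [hK1, hK2]; ring
          _ = C * W * (D * g) + (2 * C + 1) * 2 ^ δ * 2 * W * (E * w) := by rw [hDh, one_mul]
          _ ≤ C * W * (2 ^ d * G) + (2 * C + 1) * 2 ^ δ * 2 * W * (2 ^ δ * H) := by gcongr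
          _ ≤ _ := by
            have A : 0 ≤ C * W * 2 ^ d := by positivity
            have B : 0 ≤ (2 * C + 1) * 2 ^ δ * 2 * W * 2 ^ δ := by positivity
            nlinarith [mul_nonneg A hEp, mul_nonneg B hGp]
end
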